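/- arXiv:1705.02066 — 4 statements merged into one kernel-verified Lean document; each statement's English description precedes it below -/
import Mathlib

section
/- Let Γ be a primitive strongly regular graph with parameters (v, k, λ, μ), eigenvalues k, e⁺, e⁻ (with multiplicity m⁻ of e⁻) satisfying v·e⁻ = m⁻(e⁻ − k), and let Y be a Delsarte coclique of Γ. For each vertex z ∉ Y set b_z = { y ∈ Y : y is adjacent to z }. Then: (1) |Y| = m⁻; (2) |b_z| = −e⁻ for every z ∉ Y; (3) every pair of distinct vertices of Y lies in exactly μ of the sets b_z (z ∉ Y); (4) every vertex of Y lies in exactly k of the sets b_z; (5) for distinct vertices z, z' ∉ Y, |b_z ∩ b_{z'}| = −(e⁺)² − e⁺ − e⁻ if z and z' are adjacent, and |b_z ∩ b_{z'}| = −(e⁺)² − e⁻ if z and z' are non-adjacent. In other words, the sets b_z form a quasisymmetric 2-(m⁻, −e⁻, μ) design with replication number k and intersection numbers −(e⁺)² − e⁺ − e⁻ and −(e⁺)² − e⁻. -/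
/-- `Y` is a coclique (independent set) in the graph `G`. -/
def IsCoclique {V : Type*} (G : SimpleGraph V) (Y : Finset V) : Prop :=
  ∀ x ∈ Y, ∀ y ∈ Y, ¬ G.Adj x y

/-- `Y` is a Delsarte coclique: an independent set whose size equals
`v * e⁻ / (e⁻ - k)`, i.e. meeting Hoffman's ratio bound with equality. -/
def IsDelsarteCoclique {V : Type*} (G : SimpleGraph V) (v k : ℕ) (eN : ℤ)
    (Y : Finset V) : Prop :=
  IsCoclique G Y ∧ (Y.card : ℤ) * (eN - (k : ℤ)) = (v : ℤ) * eN

open Finset in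
/-- The entries of the squared adjacency matrix of a strongly regular graph. -/
theorem SimpleGraph.IsSRGWith.sum_adjMatrix_mul_adjMatrix
    {V : Type*} [Fintype V] [DecidableEq V] {G : SimpleGraph V} [DecidableRel G.Adj]
    {v k l m : ℕ} (h : G.IsSRGWith v k l m) (x y : V) :
    ∑ z, G.adjMatrix ℤ z x * G.adjMatrix ℤ z y =
      if x = y then (k : ℤ) else if G.Adj x y then (l : ℤ) else m := by
  have key : ∑ z, G.adjMatrix ℤ z x * G.adjMatrix ℤ z y =
      (#(univ.filter fun z => G.Adj x z ∧ G.Adj y z) : ℤ) := by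
    rw [card_filter]
    push_cast
    refine sum_congr rfl fun z _ => ?_
    simp only [SimpleGraph.adjMatrix_apply, G.adj_comm z]
    split_ifs <;> simp_all
  have common : #(univ.filter fun z => G.Adj x z ∧ G.Adj y z) =
      Fintype.card (G.commonNeighbors x y) := by
    rw [← Set.toFinset_card]
    congr 1
    ext z
    simp [SimpleGraph.mem_commonNeighbors]
  rw [key]
  split_ifs with hxy hadj
  · subst hxy
    have := h.regular x
    rw [← G.card_neighborFinset_eq_degree, G.neighborFinset_eq_filter] at this
    simpa using this
  · rw [common, h.of_adj x y hadj]
  · rw [common, h.of_not_adj hxy hadj]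

theorem SimpleGraph.IsSRGWith.sum_adjMatrix_left
    {V : Type*} [Fintype V] {G : SimpleGraph V} [DecidableRel G.Adj]
    {v k l m : ℕ} (h : G.IsSRGWith v k l m) (x : V) :
    ∑ z, G.adjMatrix ℤ z x = k := by
  have := h.regular x
  rw [← G.card_neighborFinset_eq_degree, G.neighborFinset_eq_filter, Finset.card_filter] at this
  rw [← this]
  push_cast
  simp [SimpleGraph.adjMatrix_apply, G.adj_comm x]

/-- The Gram form of the adjacency vectors of a coclique in a strongly regular graph. -/
theorem SimpleGraph.IsSRGWith.sum_sq_sum_mul_adjMatrix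
    {V : Type*} [Fintype V] [DecidableEq V] {G : SimpleGraph V} [DecidableRel G.Adj]
    {v k l m : ℕ} (h : G.IsSRGWith v k l m) {Y : Finset V} (hY : IsCoclique G Y) (f : V → ℤ) :
    ∑ z, (∑ y ∈ Y, f y * G.adjMatrix ℤ z y) ^ 2 =
      m * (∑ y ∈ Y, f y) ^ 2 + (k - m) * ∑ y ∈ Y, f y ^ 2 := by
  calc ∑ z, (∑ y ∈ Y, f y * G.adjMatrix ℤ z y) ^ 2
      = ∑ x ∈ Y, ∑ y ∈ Y, f x * f y * ∑ z, G.adjMatrix ℤ z x * G.adjMatrix ℤ z y := by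
        simp_rw [sq, Finset.sum_mul_sum, Finset.mul_sum]
        rw [Finset.sum_comm]
        refine Finset.sum_congr rfl fun x _ => ?_
        rw [Finset.sum_comm]
        refine Finset.sum_congr rfl fun y _ => Finset.sum_congr rfl fun z _ => ?_
        ring
    _ = ∑ x ∈ Y, ∑ y ∈ Y, (m * (f x * f y) + if x = y then (k - m) * (f x * f y) else 0) := by
        refine Finset.sum_congr rfl fun x hx => Finset.sum_congr rfl fun y hy => ?_
        rw [h.sum_adjMatrix_mul_adjMatrix, if_neg (hY x hx y hy)]
        split_ifs <;> ring
    _ = m * (∑ y ∈ Y, f y) ^ 2 + (k - m) * ∑ y ∈ Y, f y ^ 2 := by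
        rw [sq, Finset.sum_mul_sum]
        simp only [Finset.sum_add_distrib, Finset.mul_sum, Finset.sum_ite_eq]
        congr 1
        refine Finset.sum_congr rfl fun x hx => ?_
        rw [if_pos hx, sq]

/-- A connected strongly regular graph with connected complement that is not a single vertex has
degree `k` with `0 < k < v - 1`. -/
theorem SimpleGraph.IsSRGWith.degree_bounds
    {V : Type*} [Fintype V] [DecidableEq V] [Nontrivial V] {G : SimpleGraph V}
    [DecidableRel G.Adj] {v k l m : ℕ} (h : G.IsSRGWith v k l m)
    (hG : G.Connected) (hGc : Gᶜ.Connected) : 0 < k ∧ k + 1 < v := by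
  obtain ⟨x⟩ := hG.nonempty
  have h1 := hG.preconnected.degree_pos_of_nontrivial x
  have h2 := hGc.preconnected.degree_pos_of_nontrivial x
  rw [h.regular x] at h1
  rw [h.compl_is_regular x] at h2
  omega

/-- Double counting of paths of length two, over the integers. -/
theorem SimpleGraph.IsSRGWith.sq_degree_eq
    {V : Type*} [Fintype V] [DecidableEq V] [Nonempty V] {G : SimpleGraph V}
    [DecidableRel G.Adj] {v k l m : ℕ} (h : G.IsSRGWith v k l m) :
    (k : ℤ) * k = k + l * k + m * (v - 1 - k) := by
  obtain ⟨x⟩ := ‹Nonempty V›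
  calc (k : ℤ) * k = ∑ z, G.adjMatrix ℤ z x * k := by
        rw [← Finset.sum_mul, h.sum_adjMatrix_left]
    _ = ∑ y, ∑ z, G.adjMatrix ℤ z x * G.adjMatrix ℤ z y := by
        rw [Finset.sum_comm]
        refine Finset.sum_congr rfl fun z _ => ?_
        rw [← Finset.mul_sum, ← h.sum_adjMatrix_left z]
        simp [SimpleGraph.adjMatrix_apply, G.adj_comm z]
    _ = ∑ y, ((if x = y then (k : ℤ) - m else 0) + (l - m) * G.adjMatrix ℤ y x + m) := by
        refine Finset.sum_congr rfl fun y _ => ?_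
        rw [h.sum_adjMatrix_mul_adjMatrix]
        simp only [SimpleGraph.adjMatrix_apply, G.adj_comm y]
        split_ifs with h1 h2 <;> simp_all
    _ = k + l * k + m * (v - 1 - k) := by
        simp only [Finset.sum_add_distrib, ← Finset.mul_sum, h.sum_adjMatrix_left]
        simp [h.card]
        ring

theorem srg_delsarte_quasisymmetric_design
    {V : Type*} [Fintype V] [DecidableEq V] (G : SimpleGraph V) [DecidableRel G.Adj]
    (v k l m : ℕ) (eP eN : ℤ) (mN : ℕ)
    (hsrg : G.IsSRGWith v k l m)
    (hconn : G.Connected) (hconnCompl : Gᶜ.Connected)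
    (heP : 0 ≤ eP) (heN : eN < 0)
    (hProot : eP ^ 2 - ((l : ℤ) - (m : ℤ)) * eP - ((k : ℤ) - (m : ℤ)) = 0)
    (hNroot : eN ^ 2 - ((l : ℤ) - (m : ℤ)) * eN - ((k : ℤ) - (m : ℤ)) = 0)
    (hmult : (mN : ℚ) = (v : ℚ) - 1 -
      ((eN : ℚ) + 1) * (k : ℚ) * ((k : ℚ) - (eN : ℚ)) / ((m : ℚ) * ((eN : ℚ) - (eP : ℚ))))
    (hbound : (v : ℤ) * eN = (mN : ℤ) * (eN - (k : ℤ)))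
    (Y : Finset V) (hY : IsDelsarteCoclique G v k eN Y)
    (b : V → Finset V) (hb : ∀ z, b z = Y.filter (fun y => G.Adj z y)) :
    -- (1) |Y| = m⁻
    (Y.card = mN) ∧
    -- (2) every block has size -e⁻
    (∀ z, z ∉ Y → ((b z).card : ℤ) = -eN) ∧
    -- (3) every pair of distinct points of Y lies in exactly μ blocks
    (∀ y₁ ∈ Y, ∀ y₂ ∈ Y, y₁ ≠ y₂ →
      (Finset.univ.filter (fun z => z ∉ Y ∧ y₁ ∈ b z ∧ y₂ ∈ b z)).card = m) ∧
    -- (4) every point of Y lies in exactly k blocks (replication number k)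
    (∀ y ∈ Y, (Finset.univ.filter (fun z => z ∉ Y ∧ y ∈ b z)).card = k) ∧
    -- (5) the two intersection numbers
    (∀ z, z ∉ Y → ∀ z', z' ∉ Y → z ≠ z' →
      (G.Adj z z' → ((b z ∩ b z').card : ℤ) = -eP ^ 2 - eP - eN) ∧
      (¬ G.Adj z z' → ((b z ∩ b z').card : ℤ) = -eP ^ 2 - eN)) := by
  obtain ⟨hco, hYcard⟩ := hY
  have hne : Nonempty V := hconn.nonempty
  have hvpos : 0 < v := hsrg.card ▸ Fintype.card_pos
  have hkq : eN - (k : ℤ) < 0 := by have : (0 : ℤ) ≤ k := by positivity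
                                    linarith
  have hpq : eN - eP < 0 := by linarith
  -- sum and product of the two roots
  have hsum : (l : ℤ) = m + eP + eN := by
    have : (eN - eP) * (eN + eP - (l - m)) = 0 := by linear_combination hNroot - hProot
    rcases mul_eq_zero.1 this with h | h <;> linarith
  have hprod : (m : ℤ) = k + eP * eN := by
    linear_combination hProot + eP * hsum
  have hcount := hsrg.sq_degree_eq
  have hmv : (m : ℤ) * v = (k - eN) * (k - eP) := by
    linear_combination -hcount - k * hsum + hprod
  have hntr : Nontrivial V := by
    by_contra hnt
    rw [not_nontrivial_iff_subsingleton] at hnt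
    have hv1 : v = 1 := le_antisymm (hsrg.card ▸ Fintype.card_le_one_iff_subsingleton.2 hnt) hvpos
    obtain ⟨x⟩ := hne
    have hk0 : k = 0 := by
      rw [← hsrg.regular x]
      simp
    subst hk0
    have hm0 : (0 : ℤ) ≤ m := by positivity
    have hl0 : (0 : ℤ) ≤ l := by positivity
    push_cast at *
    nlinarith
  obtain ⟨hk0, hkv⟩ := hsrg.degree_bounds hconn hconnCompl
  have hkZ : (0 : ℤ) < k := by exact_mod_cast hk0
  have hkvZ : (k : ℤ) + 1 < v := by exact_mod_cast hkv
  have hmne : (m : ℤ) ≠ 0 := by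
    intro hm
    have hmQ : (m : ℚ) = 0 := by exact_mod_cast hm
    have hmN : (mN : ℤ) = v - 1 := by
      have : (mN : ℚ) = v - 1 := by rw [hmult, hmQ]; simp
      exact_mod_cast this
    rw [hmN] at hbound
    have heNk : eN = -(((v : ℤ) - 1) * k) := by linear_combination hbound
    have : eP * eN = -k := by linarith
    nlinarith
  have hYmN : (Y.card : ℤ) = mN :=
    mul_right_cancel₀ hkq.ne (hYcard.trans hbound)
  obtain ⟨n, hn⟩ : ∃ n : ℤ, n = Y.card := ⟨_, rfl⟩
  rw [← hn] at hYcard hYmN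
  -- the condition that the ratio bound equals the inertia bound
  have hkp : (k : ℤ) - eP ≠ 0 := by
    intro h
    rw [h, mul_zero] at hmv
    rcases mul_eq_zero.1 hmv with h | h
    · exact hmne h
    · linarith
  have hnm : n * m = -eN * (k - eP) := by
    refine mul_right_cancel₀ hkq.ne ?_
    linear_combination m * hYcard + eN * hmv
  have hmultZ : n * (m * (eN - eP)) = (v - 1) * (m * (eN - eP)) - (eN + 1) * k * (k - eN) := by
    have hm' : (m : ℚ) ≠ 0 := by exact_mod_cast hmne
    have hpq' : (eN : ℚ) - eP ≠ 0 := by exact_mod_cast hpq.ne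
    rw [hYmN]
    have : (mN : ℚ) * (m * (eN - eP)) =
        (v - 1) * (m * (eN - eP)) - (eN + 1) * k * (k - eN) := by
      rw [hmult]
      field_simp
    exact_mod_cast this
  have hrel : (eP + 1) * k = eN * (eN - eP) := by
    have : ((k : ℤ) - eP) * ((eP + 1) * k - eN * (eN - eP)) = 0 := by
      linear_combination hmultZ - (eN - eP) * hnm + (eN - eP) * hmv - (eN - eP) * hprod
    linarith [(mul_eq_zero.1 this).resolve_left hkp]
  have hcompl : (eP ^ 2 + eN) * (v - n) = (eN - eP) * (k - eP) := by
    have h1 : (v - n) * m = k * (k - eP) := by linear_combination hmv - hnm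
    have h2 : (eP + 1) * m = eN * (eP ^ 2 + eN) := by
      linear_combination (eP + 1) * hprod + hrel
    refine mul_left_cancel₀ (mul_ne_zero heN.ne hmne) ?_
    linear_combination -(v - n) * m * h2 + (eP + 1) * m * h1 + m * (k - eP) * hrel
  -- block sizes
  set a : V → V → ℤ := fun x y => G.adjMatrix ℤ x y with ha
  have ha01 : ∀ x y, a x y = if G.Adj x y then 1 else 0 := fun x y => by
    simp [ha, SimpleGraph.adjMatrix_apply]
  have hasymm : ∀ x y, a x y = a y x := fun x y => by
    simp only [ha01, G.adj_comm x]
  have hasq : ∀ x y, a x y ^ 2 = a x y := fun x y => by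
    rw [ha01]; split_ifs <;> simp
  have haY : ∀ x ∈ Y, ∀ y ∈ Y, a x y = 0 := fun x hx y hy => by
    rw [ha01, if_neg (hco x hx y hy)]
  have hdeg : ∀ x, ∑ z, a z x = k := hsrg.sum_adjMatrix_left
  have hbcard : ∀ z, ((b z).card : ℤ) = ∑ y ∈ Y, a z y := fun z => by
    rw [hb, Finset.card_filter]
    push_cast
    simp only [ha01]
  have hblock : ∀ z ∉ Y, ∑ y ∈ Y, a z y = -eN := by
    have h1 : ∑ z, (∑ y ∈ Y, a z y) ^ 2 = m * n ^ 2 + (k - m) * n := by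
      have := hsrg.sum_sq_sum_mul_adjMatrix hco (fun _ => 1)
      simp only [one_mul, one_pow, Finset.sum_const, nsmul_eq_mul, mul_one, ← hn] at this
      exact this
    have h2 : ∑ z, ∑ y ∈ Y, a z y = n * k := by
      rw [Finset.sum_comm]
      simp [hdeg, hn]
    have hzero : ∑ z ∈ Yᶜ, (∑ y ∈ Y, a z y + eN) ^ 2 = 0 := by
      have h3 := Finset.sum_add_sum_compl Y fun z => (∑ y ∈ Y, a z y + eN) ^ 2
      have h4 : ∑ z ∈ Y, (∑ y ∈ Y, a z y + eN) ^ 2 = n * eN ^ 2 := by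
        rw [Finset.sum_congr rfl fun z hz => by rw [Finset.sum_eq_zero (haY z hz), zero_add]]
        simp [hn]
      have h5 : ∑ z, (∑ y ∈ Y, a z y + eN) ^ 2 =
          m * n ^ 2 + (k - m) * n + 2 * eN * (n * k) + v * eN ^ 2 := by
        simp only [add_sq, Finset.sum_add_distrib, h1]
        rw [← Finset.sum_mul, ← Finset.mul_sum, h2]
        simp [hsrg.card]
        ring
      linear_combination h3 - h4 + h5 + n * hnm - n * hprod - eN * hYcard
    intro z hz
    have := (Finset.sum_eq_zero_iff_of_nonneg fun _ _ => sq_nonneg _).1 hzero z (by simpa using hz)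
    linarith [pow_eq_zero_iff (two_ne_zero) |>.1 this]
  -- intersection numbers
  have hinter : ∀ z ∉ Y, ∀ z' ∉ Y, z ≠ z' →
      ∑ y ∈ Y, a z y * a z' y = -eP * a z' z - eP ^ 2 - eN := by
    intro z hz
    set w : V → ℤ := fun z' => ∑ y ∈ Y, a z y * a z' y with hw
    have hc := hblock z hz
    have hwY : ∀ z' ∈ Y, w z' = 0 := fun z' hz' =>
      Finset.sum_eq_zero fun y hy => by rw [haY z' hz' y hy, mul_zero]
    have hww : ∑ z', w z' ^ 2 = m * eN ^ 2 + (k - m) * -eN := by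
      rw [hsrg.sum_sq_sum_mul_adjMatrix hco (a z)]
      simp only [hasq, hc]
      ring
    have hw1 : ∑ z', w z' = -eN * k := by
      rw [Finset.sum_comm, ← hc, Finset.sum_mul]
      exact Finset.sum_congr rfl fun y _ => by rw [← Finset.mul_sum, hdeg]
    have hwa : ∑ z', w z' * a z' z = -eN * l := by
      simp only [hw, Finset.sum_mul]
      rw [Finset.sum_comm, ← hc, Finset.sum_mul]
      refine Finset.sum_congr rfl fun y hy => ?_
      have hyz : y ≠ z := fun h => hz (h ▸ hy)
      simp only [mul_assoc]
      rw [← Finset.mul_sum, hsrg.sum_adjMatrix_mul_adjMatrix, if_neg hyz, ha01]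
      simp only [G.adj_comm z y]
      split_ifs <;> simp
    have hwz : w z = -eN := by
      rw [← hc]
      exact Finset.sum_congr rfl fun y _ => by rw [← sq, hasq]
    have haz : a z z = 0 := by simp [ha01]
    have htot : ∑ z' ∈ Yᶜ, (w z' + eP * a z' z + (eP ^ 2 + eN)) ^ 2 = eP ^ 4 := by
      have h3 := Finset.sum_add_sum_compl Y fun z' => (w z' + eP * a z' z + (eP ^ 2 + eN)) ^ 2
      have hexp : ∀ z', (w z' + eP * a z' z + (eP ^ 2 + eN)) ^ 2 =
          w z' ^ 2 + 2 * eP * (w z' * a z' z) + 2 * (eP ^ 2 + eN) * w z' +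
            (eP ^ 2 + 2 * eP * (eP ^ 2 + eN)) * a z' z + (eP ^ 2 + eN) ^ 2 := fun z' => by
        linear_combination eP ^ 2 * hasq z' z
      have h4 : ∑ z' ∈ Y, (w z' + eP * a z' z + (eP ^ 2 + eN)) ^ 2 =
          (eP ^ 2 + 2 * eP * (eP ^ 2 + eN)) * -eN + n * (eP ^ 2 + eN) ^ 2 := by
        rw [← hc, Finset.mul_sum, hn, ← nsmul_eq_mul, ← Finset.sum_const,
          ← Finset.sum_add_distrib]
        refine Finset.sum_congr rfl fun y hy => ?_
        rw [hexp, hwY y hy, hasymm z y]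
        ring
      have h5 : ∑ z', (w z' + eP * a z' z + (eP ^ 2 + eN)) ^ 2 =
          m * eN ^ 2 + (k - m) * -eN + 2 * eP * (-eN * l) + 2 * (eP ^ 2 + eN) * (-eN * k) +
            (eP ^ 2 + 2 * eP * (eP ^ 2 + eN)) * k + v * (eP ^ 2 + eN) ^ 2 := by
        simp only [hexp, Finset.sum_add_distrib, ← Finset.mul_sum, hww, hwa, hw1, hdeg]
        simp [hsrg.card]
      linear_combination h3 - h4 + h5 + (eP ^ 2 + eN) * hcompl - 2 * eP * eN * hsum
        + (eN ^ 2 + eN - 2 * eP * eN) * hprod - eP * (eN - eP) * hrel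
    have hzc : z ∈ Yᶜ := by simpa using hz
    rw [← Finset.add_sum_erase _ _ hzc, hwz, haz] at htot
    have hzero : ∑ z' ∈ Yᶜ.erase z, (w z' + eP * a z' z + (eP ^ 2 + eN)) ^ 2 = 0 := by
      linear_combination htot
    intro z' hz' hzz'
    have := (Finset.sum_eq_zero_iff_of_nonneg fun _ _ => sq_nonneg _).1 hzero z'
      (Finset.mem_erase.2 ⟨hzz'.symm, by simpa using hz'⟩)
    have := (pow_eq_zero_iff two_ne_zero).1 this
    change w z' = _
    linarith
  have hbinter : ∀ z z', ((b z ∩ b z').card : ℤ) = ∑ y ∈ Y, a z y * a z' y := fun z z' => by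
    rw [hb, hb, ← Finset.filter_and, Finset.card_filter]
    push_cast
    refine Finset.sum_congr rfl fun y _ => ?_
    simp only [ha01]
    split_ifs <;> simp_all
  refine ⟨by exact_mod_cast hn.symm.trans hYmN, fun z hz => (hbcard z).trans (hblock z hz), ?_, ?_, ?_⟩
  · intro x hx y hy hxy
    rw [← hsrg.of_not_adj hxy (hco x hx y hy), ← Set.toFinset_card]
    congr 1
    ext z
    have : G.Adj z x → z ∉ Y := fun h hz => hco z hz x hx h
    simp only [hb, Finset.mem_filter, Finset.mem_univ, true_and, hx, hy, Set.mem_toFinset,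
      SimpleGraph.mem_commonNeighbors, G.adj_comm x, G.adj_comm y]
    tauto
  · intro y hy
    rw [← hsrg.regular y, ← G.card_neighborFinset_eq_degree]
    congr 1
    ext z
    have : G.Adj z y → z ∉ Y := fun h hz => hco z hz y hy h
    simp only [hb, Finset.mem_filter, Finset.mem_univ, true_and, hy,
      SimpleGraph.mem_neighborFinset, G.adj_comm y]
    tauto
  · intro z hz z' hz' hzz'
    rw [hbinter, hinter z hz z' hz' hzz', hasymm z', ha01]
    refine ⟨fun h => ?_, fun h => ?_⟩
    · rw [if_pos h]; ring
    · rw [if_neg h]; ring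
end

section
/- Let Γ be a primitive strongly regular graph with eigenvalues k, e⁺, e⁻ (multiplicity m⁻ of e⁻) satisfying v·e⁻ = m⁻(e⁻ − k), and let Y, Z be two distinct Delsarte cocliques of Γ. For z ∈ Z ∖ Y set b_z = { y ∈ Y : y is adjacent to z }. Then: (1) b_z ⊆ Y ∖ Z and |b_z| = −e⁻ for each z ∈ Z ∖ Y; (2) |Y ∖ Z| = |Z ∖ Y| = ((e⁺)² − (e⁻)²)/((e⁺)² + e⁻); (3) for distinct z, z' ∈ Z ∖ Y, |b_z ∩ b_{z'}| = −(e⁺)² − e⁻ (in particular the map z ↦ b_z is injective); (4) every vertex of Y ∖ Z lies in exactly −e⁻ of the sets b_z, and every pair of distinct vertices of Y ∖ Z lies in exactly −(e⁺)² − e⁻ of the sets b_z. That is, the sets b_z form a symmetric 2-(((e⁺)² − (e⁻)²)/((e⁺)² + e⁻), −e⁻, −(e⁺)² − e⁻) design on the point set Y ∖ Z. -/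
open Finset Matrix

theorem sum_mulVec_of_isSymm {V : Type*} [Fintype V] {A : Matrix V V ℤ} (hA : A.IsSymm) {k : ℤ}
    (hone : A *ᵥ 1 = k • 1) (f : V → ℤ) : ∑ x, (A *ᵥ f) x = k * ∑ x, f x := by
  have h : (1 : V → ℤ) ⬝ᵥ (A *ᵥ f) = k * ((1 : V → ℤ) ⬝ᵥ f) := by
    rw [dotProduct_mulVec, ← mulVec_transpose, hA.eq, hone, smul_dotProduct, smul_eq_mul]
  simpa [dotProduct] using h

theorem residual_eq_zero {V : Type*} [Fintype V] [Nonempty V] {A : Matrix V V ℤ}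
    (hA : A.IsSymm) {k p q μ : ℤ} (hone : A *ᵥ 1 = k • 1)
    (hsq : ∀ f : V → ℤ,
      A *ᵥ (A *ᵥ f) = (p + q) • (A *ᵥ f) - (p * q) • f + (μ * ∑ x, f x) • 1)
    (w t : V → ℤ) (β : ℤ) (ht : t = A *ᵥ w - p • w - β • 1)
    (hsum : ∑ x, t x = 0) (hw : w ⬝ᵥ t = 0) : t = 0 := by
  set c : ℤ := q * β + μ * ∑ x, w x - β * k with hc
  have hAt : A *ᵥ t = q • t + c • 1 := by
    rw [ht, mulVec_sub, mulVec_sub, mulVec_smul, mulVec_smul, hone, hsq, hc]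
    ext x
    simp only [Pi.add_apply, Pi.sub_apply, Pi.smul_apply, Pi.one_apply, smul_eq_mul]
    ring
  have hc0 : c = 0 := by
    have h := sum_mulVec_of_isSymm hA hone t
    rw [hAt, hsum] at h
    simpa [sum_add_distrib, ← mul_sum, hsum] using h
  have hself : t ⬝ᵥ t = 0 := by
    have h1 : t ⬝ᵥ (1 : V → ℤ) = 0 := by simpa [dotProduct] using hsum
    have h2 : t ⬝ᵥ (A *ᵥ w) = 0 := by
      rw [dotProduct_mulVec, ← mulVec_transpose, hA.eq, hAt, hc0, zero_smul, add_zero,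
        smul_dotProduct, dotProduct_comm, hw, smul_zero]
    conv_lhs => rw [ht]
    rw [← ht, dotProduct_comm]
    nth_rw 2 [ht]
    rw [dotProduct_sub, dotProduct_sub, dotProduct_smul, dotProduct_smul, h1, h2,
      dotProduct_comm t w, hw]
    simp
  exact dotProduct_self_eq_zero.mp hself

theorem subsingleton_of_connected_of_connected_compl {V : Type*} {H : SimpleGraph V}
    (hH : H.Connected) (hHc : Hᶜ.Connected)
    (htrans : ∀ x y z, H.Adj x y → H.Adj y z → x ≠ z → H.Adj x z) : Subsingleton V := by
  have hwalk : ∀ x y, H.Walk x y → x = y ∨ H.Adj x y := by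
    intro x y p
    induction p with
    | nil => exact Or.inl rfl
    | @cons a b c hab _ ih =>
      rcases eq_or_ne a c with h | h
      · exact Or.inl h
      · rcases ih with rfl | ih
        · exact Or.inr hab
        · exact Or.inr (htrans a b c hab ih h)
  by_contra hns
  rw [not_subsingleton_iff_nontrivial] at hns
  obtain ⟨x⟩ := hH.nonempty
  obtain ⟨y, hy⟩ := hHc.preconnected.exists_adj_of_nontrivial x
  rw [SimpleGraph.compl_adj] at hy
  obtain ⟨p⟩ := hH.preconnected x y
  exact (hwalk x y p).elim hy.1 hy.2

theorem adjMatrix_mulVec_one {V : Type*} [Fintype V] {G : SimpleGraph V} [DecidableRel G.Adj]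
    {k : ℕ} (h : G.IsRegularOfDegree k) : G.adjMatrix ℤ *ᵥ 1 = (k : ℤ) • 1 := by
  ext x
  simp [SimpleGraph.adjMatrix_mulVec_apply, h x]

theorem adjMatrix_mulVec_indicator {V : Type*} [Fintype V] [DecidableEq V] (G : SimpleGraph V)
    [DecidableRel G.Adj] (Y : Finset V) (x : V) :
    (G.adjMatrix ℤ *ᵥ fun y => if y ∈ Y then 1 else 0) x = #{y ∈ Y | G.Adj x y} := by
  rw [SimpleGraph.adjMatrix_mulVec_apply, ← sum_filter, sum_const, nsmul_one]
  congr 2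
  ext y
  simp [and_comm]

theorem adjMatrix_mulVec_mulVec {V : Type*} [Fintype V] [DecidableEq V] {G : SimpleGraph V}
    [DecidableRel G.Adj] {v k l m : ℕ} (h : G.IsSRGWith v k l m) {r s : ℤ}
    (hadd : r + s = l - m) (hmul : r * s = m - k) (f : V → ℤ) :
    G.adjMatrix ℤ *ᵥ (G.adjMatrix ℤ *ᵥ f) =
      (r + s) • (G.adjMatrix ℤ *ᵥ f) - (r * s) • f + ((m : ℤ) * ∑ x, f x) • 1 := by
  have hJ : (Matrix.of fun _ _ => 1 : Matrix V V ℤ) *ᵥ f = (∑ x, f x) • 1 := by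
    ext x
    simp [mulVec, dotProduct]
  have hc : Gᶜ.adjMatrix ℤ *ᵥ f = (∑ x, f x) • 1 - f - G.adjMatrix ℤ *ᵥ f := by
    have h1 : 1 + G.adjMatrix ℤ + Gᶜ.adjMatrix ℤ = Matrix.of fun _ _ => 1 := by
      rw [← SimpleGraph.compl_adjMatrix_eq_adjMatrix_compl (G := G) (α := ℤ)]
      exact SimpleGraph.one_add_adjMatrix_add_compl_adjMatrix_eq_of_one (G := G) (α := ℤ)
    rw [← hJ, ← h1, add_mulVec, add_mulVec, one_mulVec]
    abel
  rw [mulVec_mulVec, ← sq, h.matrix_eq, add_mulVec, add_mulVec, smul_mulVec, smul_mulVec,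
    smul_mulVec, hc, one_mulVec, hadd, hmul]
  simp only [← natCast_zsmul]
  ext x
  simp only [Pi.add_apply, Pi.sub_apply, Pi.smul_apply, Pi.one_apply, smul_eq_mul]
  ring

theorem srg_card_mul_mu {V : Type*} [Fintype V] [DecidableEq V] [Nonempty V] {G : SimpleGraph V}
    [DecidableRel G.Adj] {v k l m : ℕ} (h : G.IsSRGWith v k l m) {r s : ℤ}
    (hadd : r + s = l - m) (hmul : r * s = m - k) : (v : ℤ) * m = (k - r) * (k - s) := by
  have h1 := adjMatrix_mulVec_mulVec h hadd hmul 1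
  rw [adjMatrix_mulVec_one h.regular, mulVec_smul, adjMatrix_mulVec_one h.regular] at h1
  obtain ⟨x⟩ := ‹Nonempty V›
  have h2 := congrFun h1 x
  simp only [Pi.add_apply, Pi.sub_apply, Pi.smul_apply, Pi.one_apply, smul_eq_mul, sum_const,
    card_univ, h.card, nsmul_eq_mul] at h2
  linarith

section Delsarte

variable {V : Type*} [Fintype V] [DecidableEq V] {G : SimpleGraph V} [DecidableRel G.Adj]
  {v k l m : ℕ} {r s : ℤ} {Y : Finset V}

theorem IsDelsarteCoclique.card_adj (h : G.IsSRGWith v k l m)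
    (hadd : r + s = l - m) (hmul : r * s = m - k) (hY : IsDelsarteCoclique G v k s Y)
    {x : V} (hx : x ∉ Y) : (#{y ∈ Y | G.Adj x y} : ℤ) = -s := by
  have : Nonempty V := ⟨x⟩
  have hsymm : (G.adjMatrix ℤ).IsSymm := G.isSymm_adjMatrix
  have hone := adjMatrix_mulVec_one h.regular
  set w : V → ℤ := fun y => if y ∈ Y then 1 else 0 with hw
  set t : V → ℤ := G.adjMatrix ℤ *ᵥ w - s • w - (-s) • 1 with ht
  have htx : ∀ x, t x = #{y ∈ Y | G.Adj x y} - s * w x + s := by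
    intro x
    rw [ht]
    simp only [Pi.sub_apply, Pi.smul_apply, Pi.one_apply, smul_eq_mul]
    rw [hw, adjMatrix_mulVec_indicator]
    ring
  have hwsum : ∑ x, w x = #Y := by simp [hw]
  have hsum : ∑ x, t x = 0 := by
    rw [ht]
    simp only [Pi.sub_apply, Pi.smul_apply, Pi.one_apply, smul_eq_mul, sum_sub_distrib]
    rw [sum_mulVec_of_isSymm hsymm hone, ← mul_sum, hwsum]
    simp only [sum_const, card_univ, h.card, nsmul_eq_mul]
    linarith [hY.2]
  have hwt : w ⬝ᵥ t = 0 := by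
    refine sum_eq_zero fun y _ => ?_
    by_cases hy : y ∈ Y
    · have h0 : #{u ∈ Y | G.Adj y u} = 0 :=
        card_eq_zero.mpr (filter_eq_empty_iff.mpr fun u hu => hY.1 y hy u hu)
      rw [htx, h0]
      simp [hw, hy]
    · simp [hw, hy]
  have ht0 := residual_eq_zero (q := r) hsymm hone
    (by simpa only [add_comm s r, mul_comm s r] using adjMatrix_mulVec_mulVec h hadd hmul)
    w t (-s) ht hsum hwt
  have hfin := htx x
  rw [ht0] at hfin
  simp only [hw, hx, if_false, Pi.zero_apply] at hfin
  linarith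

theorem IsDelsarteCoclique.card_adj_adj (h : G.IsSRGWith v k l m)
    (hadd : r + s = l - m) (hmul : r * s = m - k) (hrs : r ≠ s) (hm : m ≠ 0)
    (hk : (k : ℤ) * (1 + r) = s * (s - r)) (hsk : s ≠ k)
    (hY : IsDelsarteCoclique G v k s Y) {z z' : V} (hz : z ∉ Y) (hz' : z' ∉ Y) (hne : z ≠ z')
    (hadj : ¬ G.Adj z z') :
    (#({y ∈ Y | G.Adj z y} ∩ {y ∈ Y | G.Adj z' y}) : ℤ) = -r ^ 2 - s := by
  have : Nonempty V := ⟨z⟩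
  have hsymm : (G.adjMatrix ℤ).IsSymm := G.isSymm_adjMatrix
  have hone := adjMatrix_mulVec_one h.regular
  set B : Finset V := {y ∈ Y | G.Adj z y} with hB
  have hBY : B ⊆ Y := filter_subset _ _
  set e : V → ℤ := fun y => if y ∈ ({z} : Finset V) then 1 else 0 with he
  set f : V → ℤ := fun y => if y ∈ B then 1 else 0 with hf
  set g : V → ℤ := fun y => if y ∈ Y then 1 else 0 with hg
  set w : V → ℤ := ((r - s) * r) • e + (r - s) • f + (s + r ^ 2) • g with hw
  set β : ℤ := -r * (s + r ^ 2) with hβ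
  set t : V → ℤ := G.adjMatrix ℤ *ᵥ w - r • w - β • 1 with ht
  have htx : ∀ x, t x = (r - s) * r * (if G.Adj x z then 1 else 0)
      + (r - s) * #{y ∈ B | G.Adj x y} + (s + r ^ 2) * #{y ∈ Y | G.Adj x y} - r * w x - β := by
    intro x
    rw [ht]
    simp only [Pi.sub_apply, Pi.smul_apply, Pi.one_apply, smul_eq_mul]
    conv_lhs => rw [hw]
    simp only [mulVec_add, mulVec_smul, Pi.add_apply, Pi.smul_apply, smul_eq_mul]
    rw [he, hf, hg, adjMatrix_mulVec_indicator, adjMatrix_mulVec_indicator,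
      adjMatrix_mulVec_indicator, filter_singleton]
    by_cases hxz : G.Adj x z <;> simp [hxz, hw, he, hf, hg]
  have hcardB : (#B : ℤ) = -s := hY.card_adj h hadd hmul hz
  have hvm := srg_card_mul_mu h hadd hmul
  have hwsum : ∑ x, w x = (r - s) * r + (r - s) * (-s) + (s + r ^ 2) * #Y := by
    rw [← hcardB]
    simp [hw, he, hf, hg, sum_add_distrib]
    ring
  have hsum : ∑ x, t x = 0 := by
    rw [ht]
    simp only [Pi.sub_apply, Pi.smul_apply, Pi.one_apply, smul_eq_mul, sum_sub_distrib]
    rw [sum_mulVec_of_isSymm hsymm hone, ← mul_sum, hwsum]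
    simp only [sum_const, card_univ, h.card, nsmul_eq_mul]
    have hsk' : (m : ℤ) * (s - k) ≠ 0 :=
      mul_ne_zero (by exact_mod_cast hm) (sub_ne_zero.mpr hsk)
    refine (mul_eq_zero.mp ?_).resolve_left hsk'
    have hm' : (m : ℤ) = r * s + k := by linarith
    have h1 : (m : ℤ) * (s - k) * #Y = s * ((k - r) * (k - s)) := by
      linear_combination (m : ℤ) * hY.2 + s * hvm
    linear_combination ((k : ℤ) - r) * (s - k) * (r - s) * r * hk + (k - r) * (s + r ^ 2) * h1
      + (s - k) * r * (s + r ^ 2) * hvm + (k - r) * (s - k) * (r - s) ^ 2 * hm'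
  have hwt : w ⬝ᵥ t = 0 := by
    refine sum_eq_zero fun y _ => ?_
    by_cases hy : y ∈ Y
    · have h0 : #{u ∈ Y | G.Adj y u} = 0 :=
        card_eq_zero.mpr (filter_eq_empty_iff.mpr fun u hu => hY.1 y hy u hu)
      have h1 : #{u ∈ B | G.Adj y u} = 0 :=
        card_eq_zero.mpr (filter_eq_empty_iff.mpr fun u hu => hY.1 y hy u (hBY hu))
      have hyz : y ≠ z := fun hyz => hz (hyz ▸ hy)
      rw [htx, h0, h1]
      by_cases hadj' : G.Adj z y
      · simp [hw, he, hf, hg, hB, hy, hyz, hadj', hadj'.symm, hβ]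
        right
        ring
      · have : ¬ G.Adj y z := fun h => hadj' h.symm
        simp [hw, he, hf, hg, hB, hy, hyz, hadj', this, hβ]
    · have hyB : y ∉ B := fun h => hy (hBY h)
      by_cases hyz : y = z
      · have hBB : ({u ∈ B | G.Adj z u} : Finset V) = B := by
          rw [hB, filter_filter]
          simp
        have htz : t z = 0 := by
          rw [htx, hBB, ← hB, hcardB]
          simp [hw, he, hf, hg, hz, hyz ▸ hyB, hβ]
          ring
        rw [hyz, htz, mul_zero]
      · simp [hw, he, hf, hg, hy, hyz, hyB]
  have ht0 := residual_eq_zero hsymm hone (adjMatrix_mulVec_mulVec h hadd hmul)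
    w t β ht hsum hwt
  have hfin := htx z'
  have hBint : ({u ∈ B | G.Adj z' u} : Finset V) = B ∩ {y ∈ Y | G.Adj z' y} := by
    ext u
    simp only [mem_filter, mem_inter]
    exact ⟨fun hu => ⟨hu.1, hBY hu.1, hu.2⟩, fun hu => ⟨hu.1, hu.2.2⟩⟩
  have hz'B : z' ∉ B := fun h => hz' (hBY h)
  have hadj' : ¬ G.Adj z' z := fun h => hadj h.symm
  rw [ht0, hBint, hY.card_adj h hadd hmul hz'] at hfin
  simp only [hw, he, hf, hg, hz', hz'B, hadj', hne.symm, hβ, mem_singleton, if_false,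
    Pi.zero_apply, Pi.add_apply, Pi.smul_apply, smul_eq_mul] at hfin
  have hrs' : r - s ≠ 0 := sub_ne_zero.mpr hrs
  apply mul_left_cancel₀ hrs'
  linarith

end Delsarte

theorem card_sdiff_mul_eq {V : Type*} [DecidableEq V] {G : SimpleGraph V} [DecidableRel G.Adj]
    {Y Z : Finset V} {r s : ℤ} (hZY : (Z \ Y).Nonempty)
    (hrow : ∀ z ∈ Z \ Y, (#{y ∈ Y \ Z | G.Adj z y} : ℤ) = -s)
    (hcol : ∀ y ∈ Y \ Z, (#{z ∈ Z \ Y | G.Adj y z} : ℤ) = -s)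
    (hpair : ∀ z ∈ Z \ Y, ∀ z' ∈ Z \ Y, z ≠ z' →
      (#({y ∈ Y \ Z | G.Adj z y} ∩ {y ∈ Y \ Z | G.Adj z' y}) : ℤ) = -r ^ 2 - s) :
    (#(Z \ Y) : ℤ) * (r ^ 2 + s) = r ^ 2 - s ^ 2 := by
  obtain ⟨z, hz⟩ := hZY
  set B : Finset V := {y ∈ Y \ Z | G.Adj z y} with hB
  have hdc := sum_card_bipartiteAbove_eq_sum_card_bipartiteBelow
    (s := Z \ Y) (t := B) (fun z' y => G.Adj z' y)
  have habove : ∀ z', bipartiteAbove (fun z' y => G.Adj z' y) B z' =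
      B ∩ {y ∈ Y \ Z | G.Adj z' y} := by
    intro z'
    ext u
    simp only [bipartiteAbove, mem_filter, mem_inter, hB]
    tauto
  have hbelow : ∀ y ∈ B, (#(bipartiteBelow (fun z' y => G.Adj z' y) (Z \ Y) y) : ℤ) = -s := by
    intro y hy
    rw [← hcol y (mem_filter.mp hy).1]
    simp only [bipartiteBelow, G.adj_comm]
  have hright : (∑ y ∈ B, #(bipartiteBelow (fun z' y => G.Adj z' y) (Z \ Y) y) : ℤ) = s ^ 2 := by
    rw [sum_congr rfl hbelow, sum_const, nsmul_eq_mul, hB, hrow z hz]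
    ring
  have hleft : (∑ z' ∈ Z \ Y, #(bipartiteAbove (fun z' y => G.Adj z' y) B z') : ℤ) =
      -s + (#(Z \ Y) - 1) * (-r ^ 2 - s) := by
    rw [← add_sum_erase _ _ hz, habove, ← hB, inter_self, hB, hrow z hz, ← hB,
      sum_congr rfl fun z' hz' => by
        rw [habove, hpair z hz z' (mem_of_mem_erase hz') (ne_of_mem_erase hz').symm],
      sum_const, nsmul_eq_mul, card_erase_of_mem hz,
      Nat.cast_pred (card_pos.mpr ⟨z, hz⟩)]
  have hdc' : (∑ z' ∈ Z \ Y, #(bipartiteAbove (fun z' y => G.Adj z' y) B z') : ℤ) =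
      ∑ y ∈ B, (#(bipartiteBelow (fun z' y => G.Adj z' y) (Z \ Y) y) : ℤ) := by
    exact_mod_cast hdc
  rw [hleft, hright] at hdc'
  linear_combination -hdc'

theorem srg_mu_ne_zero {V : Type*} [Fintype V] [DecidableEq V] [Nontrivial V] {G : SimpleGraph V}
    [DecidableRel G.Adj] {v k l m : ℕ} (h : G.IsSRGWith v k l m)
    (hconn : G.Connected) (hconnCompl : Gᶜ.Connected) : m ≠ 0 := by
  rintro rfl
  refine not_subsingleton V (subsingleton_of_connected_of_connected_compl hconn hconnCompl ?_)
  intro x y z hxy hyz hne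
  by_contra hxz
  have h0 := h.of_not_adj hne hxz
  rw [Fintype.card_eq_zero_iff] at h0
  exact h0.elim ⟨y, hxy, hyz.symm⟩

theorem srg_mu_ne_degree {V : Type*} [Fintype V] [DecidableEq V] [Nontrivial V]
    {G : SimpleGraph V} [DecidableRel G.Adj] {v k l m : ℕ} (h : G.IsSRGWith v k l m)
    (hconn : G.Connected) (hconnCompl : Gᶜ.Connected) : m ≠ k := by
  rintro rfl
  have hN : ∀ x y, x ≠ y → ¬ G.Adj x y → G.neighborFinset x = G.neighborFinset y := by
    have hsub : ∀ x y, x ≠ y → ¬ G.Adj x y → G.neighborFinset x ⊆ G.neighborFinset y := by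
      intro x y hne hxy
      have hc := h.of_not_adj hne hxy
      have hcard : #(G.neighborFinset x ∩ G.neighborFinset y) = m := by
        rw [← hc, ← Set.toFinset_card]
        congr 1
        ext u
        simp [SimpleGraph.mem_commonNeighbors]
      refine inter_eq_left.mp (eq_of_subset_of_card_le inter_subset_left ?_)
      rw [hcard, SimpleGraph.card_neighborFinset_eq_degree, h.regular x]
    exact fun x y hne hxy =>
      (hsub x y hne hxy).antisymm (hsub y x hne.symm fun h => hxy h.symm)
  refine not_subsingleton V (subsingleton_of_connected_of_connected_compl hconnCompl
    (by rwa [compl_compl]) ?_)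
  intro x y z hxy hyz hne
  rw [SimpleGraph.compl_adj] at hxy hyz ⊢
  refine ⟨hne, fun hxz => hxy.2 ?_⟩
  have hz : x ∈ G.neighborFinset y := by
    rw [hN y z hyz.1 hyz.2, SimpleGraph.mem_neighborFinset]
    exact hxz.symm
  exact ((G.mem_neighborFinset y x).mp hz).symm

theorem srg_two_delsarte_cocliques_symmetric_design
    {V : Type*} [Fintype V] [DecidableEq V] (G : SimpleGraph V) [DecidableRel G.Adj]
    (v k l m : ℕ) (eP eN : ℤ) (mN : ℕ)
    (hsrg : G.IsSRGWith v k l m)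
    (hconn : G.Connected) (hconnCompl : Gᶜ.Connected)
    (heP : 0 ≤ eP) (heN : eN < 0)
    (hProot : eP ^ 2 - ((l : ℤ) - (m : ℤ)) * eP - ((k : ℤ) - (m : ℤ)) = 0)
    (hNroot : eN ^ 2 - ((l : ℤ) - (m : ℤ)) * eN - ((k : ℤ) - (m : ℤ)) = 0)
    (hmult : (mN : ℚ) = (v : ℚ) - 1 -
      ((eN : ℚ) + 1) * (k : ℚ) * ((k : ℚ) - (eN : ℚ)) / ((m : ℚ) * ((eN : ℚ) - (eP : ℚ))))
    (hbound : (v : ℤ) * eN = (mN : ℤ) * (eN - (k : ℤ)))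
    (Y Z : Finset V) (hY : IsDelsarteCoclique G v k eN Y)
    (hZ : IsDelsarteCoclique G v k eN Z) (hYZ : Y ≠ Z)
    (b : V → Finset V) (hb : ∀ z, b z = Y.filter (fun y => G.Adj z y)) :
    -- (1) each block is contained in Y \ Z and has size -e⁻
    (∀ z ∈ Z \ Y, b z ⊆ Y \ Z ∧ ((b z).card : ℤ) = -eN) ∧
    -- (2) the point set and block index set have the right size
    (((Y \ Z).card : ℚ) = ((eP : ℚ) ^ 2 - (eN : ℚ) ^ 2) / ((eP : ℚ) ^ 2 + (eN : ℚ))) ∧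
    (((Z \ Y).card : ℚ) = ((eP : ℚ) ^ 2 - (eN : ℚ) ^ 2) / ((eP : ℚ) ^ 2 + (eN : ℚ))) ∧
    -- (3) any two distinct blocks meet in -(e⁺)² - e⁻ points; in particular z ↦ b z is injective
    (∀ z ∈ Z \ Y, ∀ z' ∈ Z \ Y, z ≠ z' → ((b z ∩ b z').card : ℤ) = -eP ^ 2 - eN) ∧
    (∀ z ∈ Z \ Y, ∀ z' ∈ Z \ Y, b z = b z' → z = z') ∧
    -- (4) every point of Y \ Z lies in exactly -e⁻ blocks and
    --     every pair of distinct points of Y \ Z lies in exactly -(e⁺)² - e⁻ blocks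
    (∀ y ∈ Y \ Z, (((Z \ Y).filter (fun z => y ∈ b z)).card : ℤ) = -eN) ∧
    (∀ y₁ ∈ Y \ Z, ∀ y₂ ∈ Y \ Z, y₁ ≠ y₂ →
      (((Z \ Y).filter (fun z => y₁ ∈ b z ∧ y₂ ∈ b z)).card : ℤ) = -eP ^ 2 - eN) := by
  have hcards : #Y = #Z := by
    have hsk0 : eN - (k : ℤ) ≠ 0 := by omega
    exact_mod_cast mul_right_cancel₀ hsk0 (hY.2.trans hZ.2.symm)
  have hsdiff : #(Y \ Z) = #(Z \ Y) := by
    have h1 := card_sdiff_add_card_inter Y Z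
    have h2 := card_sdiff_add_card_inter Z Y
    rw [inter_comm] at h2
    omega
  have hZYne : (Z \ Y).Nonempty := by
    rw [sdiff_nonempty]
    exact fun hsub => hYZ (eq_of_subset_of_card_le hsub hcards.le).symm
  obtain ⟨y₀, hy₀⟩ : (Y \ Z).Nonempty := by
    rw [← card_pos, hsdiff]
    exact card_pos.mpr hZYne
  obtain ⟨z₀, hz₀⟩ := hZYne
  have hnt : Nontrivial V := ⟨y₀, z₀, fun h => (mem_sdiff.mp hz₀).2 (h ▸ (mem_sdiff.mp hy₀).1)⟩
  have hm0 : m ≠ 0 := srg_mu_ne_zero hsrg hconn hconnCompl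
  have hmk : m ≠ k := srg_mu_ne_degree hsrg hconn hconnCompl
  have hrs : eP ≠ eN := by omega
  have hadd : eP + eN = l - m := by
    apply mul_left_cancel₀ (sub_ne_zero.mpr hrs)
    linear_combination hProot - hNroot
  have hmul : eP * eN = m - k := by
    linear_combination eP * hadd - hProot
  have hsk : eN ≠ k := by omega
  have hvm := srg_card_mul_mu hsrg hadd hmul
  have hv : (v : ℤ) ≠ 0 := by
    rw [← hsrg.card]
    exact_mod_cast Fintype.card_ne_zero
  have hmZ : (m : ℤ) ≠ 0 := by exact_mod_cast hm0
  have hkr : (k : ℤ) - eP ≠ 0 := by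
    intro h0
    rw [h0, zero_mul] at hvm
    exact mul_ne_zero hv hmZ hvm
  have hk : (k : ℤ) * (1 + eP) = eN * (eN - eP) := by
    have hmult' : (mN : ℤ) * (m * (eN - eP)) =
        (v - 1) * (m * (eN - eP)) - (eN + 1) * k * (k - eN) := by
      have hd : (m : ℚ) * ((eN : ℚ) - (eP : ℚ)) ≠ 0 := by
        exact_mod_cast mul_ne_zero hmZ (sub_ne_zero.mpr hrs.symm)
      have hq : (mN : ℚ) * (m * (eN - eP)) =
          (v - 1) * (m * (eN - eP)) - (eN + 1) * k * (k - eN) := by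
        rw [hmult, sub_mul, div_mul_cancel₀ _ hd]
      exact_mod_cast hq
    have hmN : (mN : ℤ) * m = -eN * (k - eP) := by
      apply mul_right_cancel₀ (sub_ne_zero.mpr hsk)
      linear_combination -(m : ℤ) * hbound + eN * hvm
    apply mul_left_cancel₀ hkr
    have hm' : (m : ℤ) = eP * eN + k := by linarith
    linear_combination hmult' - (eN - eP) * hmN + (eN - eP) * hvm - (eN - eP) * hm'
  have hrow : ∀ {Y Z : Finset V}, IsDelsarteCoclique G v k eN Y →
      IsDelsarteCoclique G v k eN Z → ∀ z ∈ Z \ Y,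
      ({y ∈ Y | G.Adj z y} : Finset V) = {y ∈ Y \ Z | G.Adj z y} ∧
        (#{y ∈ Y \ Z | G.Adj z y} : ℤ) = -eN := by
    intro Y Z hY hZ z hz
    rw [mem_sdiff] at hz
    have heq : ({y ∈ Y | G.Adj z y} : Finset V) = {y ∈ Y \ Z | G.Adj z y} := by
      ext y
      simp only [mem_filter, mem_sdiff]
      exact ⟨fun hy => ⟨⟨hy.1, fun hyZ => hZ.1 z hz.1 y hyZ hy.2⟩, hy.2⟩,
        fun hy => ⟨hy.1.1, hy.2⟩⟩
    exact ⟨heq, heq ▸ hY.card_adj hsrg hadd hmul hz.2⟩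
  have hpair : ∀ {Y Z : Finset V}, IsDelsarteCoclique G v k eN Y →
      IsDelsarteCoclique G v k eN Z → ∀ z ∈ Z \ Y, ∀ z' ∈ Z \ Y, z ≠ z' →
      (#({y ∈ Y \ Z | G.Adj z y} ∩ {y ∈ Y \ Z | G.Adj z' y}) : ℤ) = -eP ^ 2 - eN := by
    intro Y Z hY hZ z hz z' hz' hne
    rw [← (hrow hY hZ z hz).1, ← (hrow hY hZ z' hz').1]
    rw [mem_sdiff] at hz hz'
    exact hY.card_adj_adj hsrg hadd hmul hrs hm0 hk hsk hz.2 hz'.2 hne (hZ.1 z hz.1 z' hz'.1)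
  have hbZ : ∀ z ∈ Z \ Y, b z = ({y ∈ Y \ Z | G.Adj z y} : Finset V) := fun z hz =>
    (hb z).trans (hrow hY hZ z hz).1
  have hbY : ∀ y ∈ Y \ Z, ({z ∈ Z \ Y | y ∈ b z} : Finset V) = {z ∈ Z \ Y | G.Adj y z} := by
    intro y hy
    refine filter_congr fun z _ => ?_
    rw [hb, mem_filter, G.adj_comm]
    exact and_iff_right (mem_sdiff.mp hy).1
  have hcount : (#(Z \ Y) : ℤ) * (eP ^ 2 + eN) = eP ^ 2 - eN ^ 2 :=
    card_sdiff_mul_eq ⟨z₀, hz₀⟩ (fun z hz => (hrow hY hZ z hz).2)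
      (fun y hy => (hrow hZ hY y hy).2) (hpair hY hZ)
  have hden : eP ^ 2 + eN ≠ 0 := by
    intro h0
    rw [h0, mul_zero] at hcount
    have h1 : eN * (eN + 1) = 0 := by linarith
    have h2 : eN = -1 := by
      rcases mul_eq_zero.mp h1 with h | h <;> omega
    have h3 : eP = 1 := by
      rw [h2] at h0
      nlinarith
    rw [h2, h3] at hmul hk
    omega
  have hsize : (#(Z \ Y) : ℚ) = ((eP : ℚ) ^ 2 - (eN : ℚ) ^ 2) / ((eP : ℚ) ^ 2 + (eN : ℚ)) := by
    rw [eq_div_iff (by exact_mod_cast hden)]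
    exact_mod_cast hcount
  have hblock : ∀ z ∈ Z \ Y, ∀ z' ∈ Z \ Y, z ≠ z' →
      (#(b z ∩ b z') : ℤ) = -eP ^ 2 - eN := by
    intro z hz z' hz' hne
    rw [hbZ z hz, hbZ z' hz']
    exact hpair hY hZ z hz z' hz' hne
  refine ⟨fun z hz => ?_, ?_, hsize, hblock, fun z hz z' hz' heq => ?_, fun y hy => ?_,
    fun y₁ hy₁ y₂ hy₂ hne => ?_⟩
  · rw [hbZ z hz]
    exact ⟨filter_subset _ _, (hrow hY hZ z hz).2⟩
  · rw [hsdiff, hsize]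
  · by_contra hne
    have h1 := hblock z hz z' hz' hne
    rw [← heq, inter_self, hbZ z hz, (hrow hY hZ z hz).2] at h1
    have h2 : eP = 0 := by
      rw [← sq_eq_zero_iff]
      linarith
    rw [h2] at hmul
    omega
  · rw [hbY y hy]
    exact (hrow hZ hY y hy).2
  · rw [filter_and, hbY y₁ hy₁, hbY y₂ hy₂]
    exact hpair hZ hY y₁ hy₁ y₂ hy₂ hne
end

section
/- Let Γ be a primitive strongly regular graph with eigenvalues k, e⁺, e⁻ (multiplicity m⁻ of e⁻) satisfying v·e⁻ = m⁻(e⁻ − k). Then any two distinct Delsarte cocliques Y and Z of Γ satisfy |Y ∩ Z| = m⁻ − ((e⁺)² − (e⁻)²)/((e⁺)² + e⁻) = (e⁻ + 1)e⁺/((e⁺)² + e⁻). -/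
section

open Matrix Finset

namespace Matrix

variable {V : Type*} [Fintype V]

/-- If `N` is symmetric with `N * N = θ • N` and `W` is a symmetric generalized inverse of a
compression of `N` of full rank, then `N = N * W * N`. -/
theorem eq_mul_mul_self_of_trace_eq {N W : Matrix V V ℚ} {θ : ℚ} (hN : Nᵀ = N) (hW : Wᵀ = W)
    (hNN : N * N = θ • N) (hWNW : W * N * W = W) (htr : N.trace = θ * (W * N).trace) :
    N = N * W * N := by
  have hsymm : (N - N * W * N)ᴴ = N - N * W * N := by
    rw [conjTranspose_eq_transpose_of_trivial]
    simp only [transpose_sub, transpose_mul, hN, hW, Matrix.mul_assoc]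
  have h1 : N * (N * W * N) = θ • (N * W * N) := by
    simp only [← Matrix.mul_assoc, hNN, Matrix.smul_mul]
  have h2 : N * W * N * N = θ • (N * W * N) := by
    rw [Matrix.mul_assoc, hNN, Matrix.mul_smul]
  have h3 : N * W * N * (N * W * N) = θ • (N * W * N) := by
    calc N * W * N * (N * W * N) = N * W * (N * N) * W * N := by simp only [Matrix.mul_assoc]
      _ = θ • (N * (W * N * W) * N) := by
        rw [hNN]; simp only [Matrix.mul_smul, Matrix.smul_mul, Matrix.mul_assoc]
      _ = θ • (N * W * N) := by rw [hWNW]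
  have h4 : (N * W * N).trace = θ * (W * N).trace := by
    rw [Matrix.mul_assoc, trace_mul_comm, Matrix.mul_assoc, hNN, Matrix.mul_smul, trace_smul,
      smul_eq_mul]
  have hsq : (N - N * W * N) * (N - N * W * N) = θ • (N - N * W * N) := by
    rw [sub_mul, mul_sub, mul_sub, h1, h2, h3, hNN]
    module
  rw [← sub_eq_zero, ← trace_conjTranspose_mul_self_eq_zero_iff, hsymm, hsq, trace_smul,
    trace_sub, h4, htr, sub_self, smul_zero]

end Matrix

namespace SimpleGraph

variable {V : Type*} [Fintype V] {G : SimpleGraph V} [DecidableRel G.Adj] {v k l m : ℕ}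

theorem of_one_mul_of_one (hv : Fintype.card V = v) :
    (of 1 : Matrix V V ℚ) * of 1 = (v : ℚ) • of 1 := by
  ext i j
  simp [mul_apply, hv]

theorem IsRegularOfDegree.adjMatrix_mul_of_one (h : G.IsRegularOfDegree k) :
    G.adjMatrix ℚ * of 1 = (k : ℚ) • of 1 := by
  ext i j
  simp [adjMatrix_mul_apply, h.degree_eq i]

theorem IsRegularOfDegree.of_one_mul_adjMatrix (h : G.IsRegularOfDegree k) :
    of 1 * G.adjMatrix ℚ = (k : ℚ) • of 1 := by
  ext i j
  simp [mul_adjMatrix_apply, h.degree_eq j]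

variable [DecidableEq V]

/-- The matrix `a I - A + ((k - a) / v) J`, where `A` is the adjacency matrix of `G`. When `G` is
strongly regular of degree `k` with other eigenvalues `a` and `b`, it is `a - b` times the
orthogonal projection onto the eigenspace of `b`. -/
def eigenMatrix (G : SimpleGraph V) [DecidableRel G.Adj] (v k : ℕ) (a : ℚ) : Matrix V V ℚ :=
  a • 1 - G.adjMatrix ℚ + ((k - a) / v) • of 1

theorem eigenMatrix_transpose {V : Type*} [DecidableEq V] {G : SimpleGraph V}
    [DecidableRel G.Adj] (a : ℚ) : (G.eigenMatrix v k a)ᵀ = G.eigenMatrix v k a := by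
  ext i j
  simp [eigenMatrix, one_apply, adjMatrix_apply, G.adj_comm, eq_comm]

theorem eigenMatrix_trace (hv : Fintype.card V = v) (hv0 : v ≠ 0) (a : ℚ) :
    (G.eigenMatrix v k a).trace = a * v + k - a := by
  have : (v : ℚ) ≠ 0 := by exact_mod_cast hv0
  have hJ : (of 1 : Matrix V V ℚ).trace = v := by simp [trace, hv]
  rw [eigenMatrix, trace_add, trace_sub, trace_smul, trace_smul, trace_one, trace_adjMatrix, hJ,
    hv, smul_eq_mul, smul_eq_mul]
  field_simp
  ring

theorem IsSRGWith.adjMatrix_mul_self (h : G.IsSRGWith v k l m) :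
    G.adjMatrix ℚ * G.adjMatrix ℚ =
      ((k : ℚ) - m) • 1 + ((l : ℚ) - m) • G.adjMatrix ℚ + (m : ℚ) • of 1 := by
  have hJ := G.one_add_adjMatrix_add_compl_adjMatrix_eq_of_one (α := ℚ)
  rw [compl_adjMatrix_eq_adjMatrix_compl, ← eq_sub_iff_add_eq'] at hJ
  rw [← sq, h.matrix_eq, hJ, ← Nat.cast_smul_eq_nsmul ℚ, ← Nat.cast_smul_eq_nsmul ℚ,
    ← Nat.cast_smul_eq_nsmul ℚ]
  module

theorem IsSRGWith.card_mul_eq [Nonempty V] (h : G.IsSRGWith v k l m) {a b : ℚ}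
    (hadd : a + b = l - m) (hmul : a * b = m - k) : (v : ℚ) * m = (k - a) * (k - b) := by
  have hJ := congrArg (· * of 1) h.adjMatrix_mul_self
  simp only [Matrix.mul_assoc, add_mul, Matrix.smul_mul, h.regular.adjMatrix_mul_of_one, Matrix.mul_smul,
    of_one_mul_of_one h.card, one_mul] at hJ
  obtain ⟨x⟩ := ‹Nonempty V›
  have hx := congrFun (congrFun hJ x) x
  simp at hx
  linear_combination -hx + k * hadd - hmul

theorem IsSRGWith.eigenMatrix_mul_self [Nonempty V] (h : G.IsSRGWith v k l m) {a b : ℚ}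
    (hadd : a + b = l - m) (hmul : a * b = m - k) :
    G.eigenMatrix v k a * G.eigenMatrix v k a = (a - b) • G.eigenMatrix v k a := by
  have hv : (v : ℚ) ≠ 0 := by simp [← h.card]
  have hvm := h.card_mul_eq hadd hmul
  simp only [eigenMatrix, mul_add, mul_sub, add_mul, sub_mul, Matrix.smul_mul, Matrix.mul_smul,
    h.regular.adjMatrix_mul_of_one, h.regular.of_one_mul_adjMatrix, of_one_mul_of_one h.card,
    h.adjMatrix_mul_self, one_mul, mul_one]
  match_scalars
  · linear_combination hmul
  · linear_combination -hadd
  · field_simp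
    linear_combination hvm

theorem eigenMatrix_mulVec (a b : ℚ) (x : V → ℚ) :
    G.eigenMatrix v k a *ᵥ x =
      G.eigenMatrix v k b *ᵥ x + (a - b) • (x - fun _ ↦ (∑ i, x i) / v) := by
  have h : G.eigenMatrix v k a =
      G.eigenMatrix v k b + (a - b) • 1 + (-((a - b) / v)) • of 1 := by
    rw [eigenMatrix, eigenMatrix]
    match_scalars <;> ring
  have hJ : (of 1 : Matrix V V ℚ) *ᵥ x = fun _ ↦ ∑ i, x i := by
    ext i
    simp [mulVec, dotProduct]
  rw [h, add_mulVec, add_mulVec, smul_mulVec, smul_mulVec, one_mulVec, hJ]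
  ext i
  simp
  ring

/-- The rational indicator vector of a finite set of vertices. -/
def indicatorVec (Y : Finset V) : V → ℚ := fun i ↦ if i ∈ Y then 1 else 0

theorem sum_indicatorVec (Y : Finset V) : ∑ i, indicatorVec Y i = Y.card := by
  simp [indicatorVec]

theorem indicatorVec_dotProduct (Y : Finset V) (x : V → ℚ) :
    indicatorVec Y ⬝ᵥ x = ∑ i ∈ Y, x i := by
  simp [indicatorVec, dotProduct, Finset.sum_ite_mem]

theorem diagonal_mul_eigenMatrix_mul_diagonal {Y : Finset V} (hY : IsCoclique G Y) (a : ℚ) :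
    diagonal (indicatorVec Y) * G.eigenMatrix v k a * diagonal (indicatorVec Y) =
      a • diagonal (indicatorVec Y) +
        ((k - a) / v) • vecMulVec (indicatorVec Y) (indicatorVec Y) := by
  ext i j
  rw [mul_diagonal, diagonal_mul]
  by_cases hi : i ∈ Y
  · by_cases hj : j ∈ Y
    · simp [eigenMatrix, indicatorVec, hi, hj, hY i hi j hj, diagonal_apply, one_apply,
        vecMulVec_apply]
    · have : i ≠ j := fun h ↦ hj (h ▸ hi)
      simp [indicatorVec, hi, hj, this, vecMulVec_apply]
  · simp [indicatorVec, hi, diagonal_apply, vecMulVec_apply]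

theorem indicatorVec_dotProduct_eigenMatrix_mulVec {Y : Finset V} (hY : IsCoclique G Y) (a : ℚ) :
    indicatorVec Y ⬝ᵥ G.eigenMatrix v k a *ᵥ indicatorVec Y =
      a * Y.card + (k - a) / v * Y.card ^ 2 := by
  have hd : diagonal (indicatorVec Y) *ᵥ 1 = indicatorVec Y := by
    ext i
    simp [mulVec_diagonal]
  have h := congrArg (fun M ↦ 1 ⬝ᵥ M *ᵥ 1)
    (diagonal_mul_eigenMatrix_mul_diagonal (v := v) (k := k) hY a)
  simp only [← mulVec_mulVec, hd, add_mulVec, smul_mulVec, dotProduct_add, dotProduct_smul] at h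
  rw [dotProduct_mulVec, ← mulVec_transpose, diagonal_transpose, hd] at h
  rw [h, vecMulVec_mulVec, dotProduct_one, sum_indicatorVec]
  simp [sum_indicatorVec, one_dotProduct, sq]

/-- The Hoffman bound is attained only by cocliques whose indicator vector has no component in the
eigenspace of the nontrivial eigenvalue `a`. -/
theorem IsSRGWith.eigenMatrix_mulVec_indicatorVec [Nonempty V] (h : G.IsSRGWith v k l m) {a b : ℚ}
    (hadd : a + b = l - m) (hmul : a * b = m - k) {Y : Finset V} (hY : IsCoclique G Y)
    (hcard : (Y.card : ℚ) * (b - k) = v * b) :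
    G.eigenMatrix v k a *ᵥ indicatorVec Y =
      (a - b) • (indicatorVec Y - fun _ ↦ (Y.card / v : ℚ)) := by
  have hv : (v : ℚ) ≠ 0 := by simp [← h.card]
  have h0 : G.eigenMatrix v k b *ᵥ indicatorVec Y = 0 := by
    rw [← dotProduct_self_eq_zero, dotProduct_mulVec, ← mulVec_transpose, eigenMatrix_transpose,
      mulVec_mulVec, h.eigenMatrix_mul_self (a := b) (b := a) (by linarith) (by linarith),
      smul_mulVec, smul_dotProduct, dotProduct_comm,
      indicatorVec_dotProduct_eigenMatrix_mulVec hY, smul_eq_mul]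
    field_simp
    linear_combination -(b - a) * Y.card * hcard
  rw [eigenMatrix_mulVec a b, h0, zero_add, sum_indicatorVec]

/-- The quadratic equation satisfied by the size of the intersection of a coclique `Y`, whose size
is the multiplicity of the eigenvalue `b`, with a coclique `Z` attaining the Hoffman bound. -/
theorem IsSRGWith.card_inter_quadratic [Nonempty V] (h : G.IsSRGWith v k l m) {a b c : ℚ}
    (hadd : a + b = l - m) (hmul : a * b = m - k) (ha : a ≠ 0) {Y Z : Finset V}
    (hY : IsCoclique G Y) (hZ : IsCoclique G Z)
    (hZcard : (Z.card : ℚ) * (b - k) = v * b)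
    (htr : a * v + k - a = (a - b) * Y.card)
    (hc : c * (a + (k - a) / v * Y.card) = (k - a) / v) :
    a * (a * Z.card + (k - a) / v * Z.card ^ 2) = (a - b) ^ 2 *
      ((1 - 2 * (Z.card / v)) * (Y ∩ Z).card + (Z.card / v) ^ 2 * Y.card
        - c * ((Y ∩ Z).card - Z.card / v * Y.card) ^ 2) := by
  have hv : v ≠ 0 := by simp [← h.card]
  set N := G.eigenMatrix v k a with hN
  set y := indicatorVec Y with hy
  set D := diagonal y with hD
  set K := vecMulVec y y with hK
  set t : ℚ := (k - a) / v with ht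
  have hNT : Nᵀ = N := eigenMatrix_transpose a
  have hyy : ∀ i, y i * y i = y i := by intro i; simp [hy, indicatorVec]
  have hDD : D * D = D := by simp [hD, diagonal_mul_diagonal, hyy]
  have hDK : D * K = K := by
    ext i j
    simp [hD, hK, diagonal_mul, vecMulVec_apply, ← mul_assoc, hyy]
  have hKD : K * D = K := by
    ext i j
    simp [hD, hK, mul_diagonal, vecMulVec_apply, mul_assoc, hyy]
  have hKK : K * K = (Y.card : ℚ) • K := by
    rw [hK, vecMulVec_mul_vecMulVec, hy, indicatorVec_dotProduct]
    ext i j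
    simp [vecMulVec_apply, indicatorVec]
  have hDND : D * N * D = a • D + t • K := diagonal_mul_eigenMatrix_mul_diagonal hY a
  set W := a⁻¹ • (D - c • K) with hW
  have hWT : Wᵀ = W := by
    simp [hW, hD, hK, transpose_vecMulVec]
  have hWD : W * D = W := by simp only [hW, Matrix.smul_mul, sub_mul, hDD, hKD]
  have hDW : D * W = W := by simp only [hW, Matrix.mul_smul, mul_sub, hDD, hDK]
  have hWinv : W * (D * N * D) = D := by
    rw [hDND]
    simp only [hW, Matrix.smul_mul, Matrix.mul_smul, sub_mul, mul_add, hDD, hKD, hDK, hKK]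
    match_scalars
    · field_simp
    · field_simp
      linear_combination -hc
  have hWNW : W * N * W = W := by
    calc W * N * W = W * D * N * (D * W) := by rw [hWD, hDW]
      _ = W * (D * N * D) * W := by simp only [Matrix.mul_assoc]
      _ = W := by rw [hWinv, hDW]
  have hWN : (W * N).trace = Y.card := by
    calc (W * N).trace = (D * (W * D) * N).trace := by rw [hWD, hDW]
      _ = (W * (D * N * D)).trace := by
        rw [Matrix.mul_assoc, trace_mul_comm]; simp only [Matrix.mul_assoc]
      _ = Y.card := by rw [hWinv, hD, trace_diagonal, sum_indicatorVec]
  have hfac : N = N * W * N := eq_mul_mul_self_of_trace_eq hNT hWT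
    (h.eigenMatrix_mul_self hadd hmul) hWNW (by rw [hWN, eigenMatrix_trace h.card hv, htr])
  have hq := indicatorVec_dotProduct_eigenMatrix_mulVec (v := v) (k := k) hZ a
  have hg := h.eigenMatrix_mulVec_indicatorVec hadd hmul hZ hZcard
  rw [← hN] at hq hg
  rw [hfac, ← mulVec_mulVec, ← mulVec_mulVec, dotProduct_mulVec, ← mulVec_transpose, hNT, hg] at hq
  set g : V → ℚ := (a - b) • (indicatorVec Z - fun _ ↦ (Z.card / v : ℚ)) with hgdef
  have hsum : ∑ i ∈ Y, indicatorVec Z i = (Y ∩ Z).card := by simp [indicatorVec]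
  have hyg : y ⬝ᵥ g = (a - b) * ((Y ∩ Z).card - Z.card / v * Y.card) := by
    rw [hy, indicatorVec_dotProduct]
    simp [hgdef, ← Finset.mul_sum, hsum, mul_comm]
  have hgDg : g ⬝ᵥ D *ᵥ g = (a - b) ^ 2 *
      ((1 - 2 * (Z.card / v)) * (Y ∩ Z).card + (Z.card / v) ^ 2 * Y.card) := by
    have : g ⬝ᵥ D *ᵥ g = y ⬝ᵥ fun i ↦ g i ^ 2 :=
      Finset.sum_congr rfl fun i _ ↦ by rw [hD, mulVec_diagonal]; ring
    rw [this, hy, indicatorVec_dotProduct, ← hsum]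
    have hz : ∀ i, g i ^ 2 = (a - b) ^ 2 *
        ((1 - 2 * (Z.card / v)) * indicatorVec Z i + (Z.card / v) ^ 2) := by
      intro i
      by_cases hi : i ∈ Z <;> simp [hgdef, indicatorVec, hi] <;> ring
    simp only [hz, ← Finset.mul_sum, Finset.sum_add_distrib, Finset.sum_const, nsmul_eq_mul]
    ring
  have hgKg : g ⬝ᵥ K *ᵥ g = (y ⬝ᵥ g) ^ 2 := by
    rw [hK, vecMulVec_mulVec, dotProduct_comm]
    simp [sq]
  rw [hW, smul_mulVec, sub_mulVec, smul_mulVec, dotProduct_smul, dotProduct_sub, dotProduct_smul,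
    hgDg, hgKg, hyg, smul_eq_mul, smul_eq_mul] at hq
  rw [← hq]
  field_simp

theorem IsSRGWith.mu_ne_zero [Nontrivial V] (h : G.IsSRGWith v k l m) (hG : G.Connected)
    (hGc : Gᶜ.Connected) : m ≠ 0 := by
  rintro rfl
  have hstep : ∀ x y z, G.Adj x y → G.Adj y z → x ≠ z → G.Adj x z := by
    intro x y z hxy hyz hxz
    by_contra hn
    have hcard := h.of_not_adj hxz hn
    rw [Fintype.card_eq_zero_iff] at hcard
    exact hcard.false ⟨y, hxy, hyz.symm⟩
  obtain ⟨x⟩ := hG.nonempty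
  obtain ⟨y, hxy⟩ := hGc.preconnected.exists_adj_of_nontrivial x
  rw [compl_adj] at hxy
  have hreach : ∀ z, Relation.ReflTransGen G.Adj x z → x = z ∨ G.Adj x z := by
    intro z hz
    induction hz with
    | refl => exact .inl rfl
    | @tail b c _ hbc ih =>
      rcases ih with rfl | hxb
      · exact .inr hbc
      · by_cases hxc : x = c
        · exact .inl hxc
        · exact .inr (hstep x b c hxb hbc hxc)
  exact (hreach y ((reachable_iff_reflTransGen x y).1 (hG.preconnected x y))).elim hxy.1 hxy.2

theorem IsSRGWith.mu_ne_degree [Nontrivial V] (h : G.IsSRGWith v k l m) (hG : G.Connected)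
    (hGc : Gᶜ.Connected) : m ≠ k := by
  rintro rfl
  have hstep : ∀ x y, Gᶜ.Adj x y → G.neighborFinset x = G.neighborFinset y := by
    intro x y hxy
    have hcard := h.of_not_adj hxy.1 hxy.2
    have hinter : (G.neighborFinset x ∩ G.neighborFinset y).card = m := by
      rw [← hcard, ← Set.toFinset_card]
      congr 1
      ext z
      simp [mem_commonNeighbors]
    have hx := Finset.eq_of_subset_of_card_le
      (Finset.inter_subset_left (s₁ := G.neighborFinset x) (s₂ := G.neighborFinset y))
      (by rw [hinter, card_neighborFinset_eq_degree, h.regular.degree_eq])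
    have hy := Finset.eq_of_subset_of_card_le
      (Finset.inter_subset_right (s₁ := G.neighborFinset x) (s₂ := G.neighborFinset y))
      (by rw [hinter, card_neighborFinset_eq_degree, h.regular.degree_eq])
    exact hx.symm.trans hy
  obtain ⟨x⟩ := hG.nonempty
  obtain ⟨y, hxy⟩ := hG.preconnected.exists_adj_of_nontrivial x
  have hreach : ∀ z, Relation.ReflTransGen Gᶜ.Adj x z →
      G.neighborFinset x = G.neighborFinset z := by
    intro z hz
    induction hz with
    | refl => rfl
    | tail _ hbc ih => exact ih.trans (hstep _ _ hbc)
  have hxy' := hreach y ((reachable_iff_reflTransGen x y).1 (hGc.preconnected x y))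
  have : y ∈ G.neighborFinset y := hxy' ▸ (mem_neighborFinset G x y).2 hxy
  simp at this

end SimpleGraph

end

theorem srg_two_delsarte_cocliques_intersection
    {V : Type*} [Fintype V] [DecidableEq V] (G : SimpleGraph V) [DecidableRel G.Adj]
    (v k l m : ℕ) (eP eN : ℤ) (mN : ℕ)
    (hsrg : G.IsSRGWith v k l m)
    (hconn : G.Connected) (hconnCompl : Gᶜ.Connected)
    (heP : 0 ≤ eP) (heN : eN < 0)
    (hProot : eP ^ 2 - ((l : ℤ) - (m : ℤ)) * eP - ((k : ℤ) - (m : ℤ)) = 0)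
    (hNroot : eN ^ 2 - ((l : ℤ) - (m : ℤ)) * eN - ((k : ℤ) - (m : ℤ)) = 0)
    (hmult : (mN : ℚ) = (v : ℚ) - 1 -
      ((eN : ℚ) + 1) * (k : ℚ) * ((k : ℚ) - (eN : ℚ)) / ((m : ℚ) * ((eN : ℚ) - (eP : ℚ))))
    (hbound : (v : ℤ) * eN = (mN : ℤ) * (eN - (k : ℤ)))
    (Y Z : Finset V) (hY : IsDelsarteCoclique G v k eN Y)
    (hZ : IsDelsarteCoclique G v k eN Z) (hYZ : Y ≠ Z) :
    ((Y ∩ Z).card : ℚ)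
      = (mN : ℚ) - ((eP : ℚ) ^ 2 - (eN : ℚ) ^ 2) / ((eP : ℚ) ^ 2 + (eN : ℚ)) ∧
    ((Y ∩ Z).card : ℚ)
      = ((eN : ℚ) + 1) * (eP : ℚ) / ((eP : ℚ) ^ 2 + (eN : ℚ)) := by
  have hcardZ : Z.card = Y.card := by
    have h1 : (Z.card : ℤ) * (eN - k) = Y.card * (eN - k) := hZ.2.trans hY.2.symm
    exact_mod_cast mul_right_cancel₀ (by omega : eN - (k : ℤ) ≠ 0) h1
  have hYm : mN = Y.card := by
    have h1 : (mN : ℤ) * (eN - k) = Y.card * (eN - k) := hbound.symm.trans hY.2.symm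
    exact_mod_cast mul_right_cancel₀ (by omega : eN - (k : ℤ) ≠ 0) h1
  have : Nonempty V := hconn.nonempty
  have : Nontrivial V := by
    by_contra hV
    rw [not_nontrivial_iff_subsingleton] at hV
    refine hYZ (Finset.eq_of_subset_of_card_le (fun x hx ↦ ?_) hcardZ.le)
    obtain ⟨z, hz⟩ := Finset.card_pos.1 (hcardZ ▸ Finset.card_pos.2 ⟨x, hx⟩)
    exact Subsingleton.elim z x ▸ hz
  have hlt : (Y ∩ Z).card ≠ Y.card := fun hc ↦ hYZ <|
    Finset.eq_of_subset_of_card_le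
      (Finset.inter_eq_left.1 (Finset.eq_of_subset_of_card_le Finset.inter_subset_left hc.ge))
      hcardZ.le
  have hm0 := hsrg.mu_ne_zero hconn hconnCompl
  have hmk := hsrg.mu_ne_degree hconn hconnCompl
  have haddZ : eP + eN = l - m :=
    mul_left_cancel₀ (by omega : eP - eN ≠ 0) (by linear_combination hProot - hNroot)
  have hmulZ : eP * eN = m - k := by linear_combination eP * haddZ - hProot
  have hP0 : eP ≠ 0 := by
    rintro rfl
    rw [zero_mul] at hmulZ
    omega
  have hYc : (Y.card : ℚ) * (eN - k) = v * eN := by exact_mod_cast hY.2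
  have hadd : (eP + eN : ℚ) = l - m := by exact_mod_cast haddZ
  have hmul : (eP * eN : ℚ) = m - k := by exact_mod_cast hmulZ
  have hvm := hsrg.card_mul_eq hadd hmul
  have hr : (0 : ℚ) < eP := by exact_mod_cast heP.lt_of_ne' hP0
  have hs : (eN : ℚ) < 0 := by exact_mod_cast heN
  have hm : (0 : ℚ) < m := by exact_mod_cast Nat.pos_of_ne_zero hm0
  have hv : (0 : ℚ) < v := by rw [← hsrg.card]; exact_mod_cast Fintype.card_pos
  have hk : (0 : ℚ) ≤ k := k.cast_nonneg
  have hkr : (0 : ℚ) < k - eP := pos_of_mul_pos_left (hvm ▸ mul_pos hv hm) (by linarith)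
  have htr : (eP * v + k - eP : ℚ) = (eP - eN) * Y.card := by
    rw [← hYm, hmult]
    have : (eN - eP : ℚ) ≠ 0 := by linarith
    field_simp
    linear_combination (eN - eP) * (eN * hvm - (k - eN) * hmul)
  have hpos : 0 < (k - eN : ℚ) := by linarith
  have hn : (0 : ℚ) < Y.card := by nlinarith [mul_neg_of_pos_of_neg hv hs]
  have hnm : (m * Y.card : ℚ) = -eN * (k - eP) :=
    mul_right_cancel₀ hpos.ne' (by linear_combination -(m : ℚ) * hYc - eN * hvm)
  have hk' : (k * (eP + 1) : ℚ) = eN * (eN - eP) :=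
    mul_left_cancel₀ hn.ne' (by
      linear_combination hnm - eN * htr - eP * hYc + Y.card * hmul)
  have ht : ((k - eP) / v : ℚ) = m / (k - eN) := by
    rw [div_eq_div_iff hv.ne' hpos.ne']
    linear_combination -hvm
  have hρ : (Y.card / v : ℚ) = -eN / (k - eN) := by
    rw [div_eq_div_iff hv.ne' hpos.ne']
    linear_combination -hYc
  have hk0 : (k : ℚ) ≠ 0 := by linarith
  have hPN : (eP - eN : ℚ) ≠ 0 := by linarith
  have hquad := hsrg.card_inter_quadratic (c := m / ((eP - eN) * k)) hadd hmul hr.ne' hY.1 hZ.1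
    (hcardZ ▸ hYc) htr (by
      rw [ht]
      field_simp
      linear_combination hnm)
  rw [hcardZ, ht, hρ] at hquad
  have hne : ((Y ∩ Z).card - Y.card : ℚ) ≠ 0 := sub_ne_zero.2 (by exact_mod_cast hlt)
  have hYm' : (mN : ℚ) = Y.card := by rw [hYm]
  generalize ((Y ∩ Z).card : ℚ) = x at *
  generalize (Y.card : ℚ) = n at *
  have hxm : x * m = eP * (k + eN) := by
    have hprod : (eP - eN) * (k - eN) ^ 2 * (x - n) * (x * m - eP * (k + eN)) = 0 := by
      field_simp at hquad
      linear_combination hquad - (eP * k * (k - eN) * n +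
        (eP - eN) * (2 * (k - eN) * eN * x + eN ^ 2 * n + (k - eN) ^ 2 * x)) * hnm
    have hne' : ((eP - eN) * (k - eN) ^ 2 * (x - n) : ℚ) ≠ 0 :=
      mul_ne_zero (mul_ne_zero hPN (pow_ne_zero 2 hpos.ne')) hne
    exact sub_eq_zero.1 ((mul_eq_zero.1 hprod).resolve_left hne')
  have hD : (eN * (eP ^ 2 + eN) : ℚ) = (eP + 1) * m := by
    linear_combination (eP + 1) * hmul - hk'
  have hD0 : (eP ^ 2 + eN : ℚ) ≠ 0 := fun h0 ↦ by
    rw [h0, mul_zero] at hD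
    nlinarith
  have hx : x * (eP ^ 2 + eN) = (eN + 1) * eP :=
    mul_left_cancel₀ hs.ne (by linear_combination x * hD + (eP + 1) * hxm + eP * hk')
  have hnD : n * (eP ^ 2 + eN) = eP ^ 2 + eP + eP * eN - eN ^ 2 :=
    mul_left_cancel₀ hs.ne (by linear_combination n * hD + (eP + 1) * hnm - eN * hk')
  constructor
  · rw [hYm']
    field_simp
    linear_combination hx - hnD
  · rw [eq_div_iff hD0, hx]
end

section
/- Let Γ be a primitive strongly regular graph with eigenvalues k, e⁺, e⁻ (multiplicity m⁻ of e⁻) satisfying v·e⁻ = m⁻(e⁻ − k). Then the number of distinct Delsarte cocliques of Γ is at most m⁻ + 1. -/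
/-- The characteristic vector of a finite set. -/
def charVec {V : Type*} [DecidableEq V] (Y : Finset V) : V → ℝ := fun x => if x ∈ Y then 1 else 0

section

open Matrix Finset Module

variable {V : Type*} [Fintype V] [DecidableEq V]

theorem dotProduct_charVec (f : V → ℝ) (Y : Finset V) : f ⬝ᵥ charVec Y = ∑ y ∈ Y, f y := by
  simp [dotProduct, charVec]

theorem charVec_dotProduct_charVec (Y Z : Finset V) :
    charVec Y ⬝ᵥ charVec Z = ((Y ∩ Z).card : ℝ) := by
  rw [dotProduct_charVec]
  simp [charVec, Finset.inter_comm]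

theorem one_dotProduct_charVec (Y : Finset V) : (1 : V → ℝ) ⬝ᵥ charVec Y = (Y.card : ℝ) := by
  simp [dotProduct_charVec]

/-- A Fisher-type inequality: equicardinal sets with constant pairwise intersection
sizes have linearly independent characteristic vectors. -/
theorem card_le_finrank_of_constant_inter (W : Submodule ℝ (V → ℝ)) (F : Finset (Finset V))
    {m : ℕ} {s : ℝ} (hs : 0 ≤ s) (hsm : s < m) (hcard : ∀ Y ∈ F, Y.card = m)
    (hinter : ∀ Y ∈ F, ∀ Z ∈ F, Y ≠ Z → ((Y ∩ Z).card : ℝ) = s)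
    (hW : ∀ Y ∈ F, charVec Y ∈ W) : F.card ≤ finrank ℝ W := by
  let b : F → W := fun Y => ⟨charVec Y.1, hW _ Y.2⟩
  have hb : LinearIndependent ℝ b := by
    rw [Fintype.linearIndependent_iff]
    intro c hc
    have h0 : ∑ Y : F, c Y • charVec Y.1 = 0 := by
      simpa [b] using congrArg (Subtype.val) hc
    have h1 : (∑ Y : F, c Y • charVec Y.1) ⬝ᵥ (∑ Y : F, c Y • charVec Y.1)
        = (m - s) * ∑ Y, c Y ^ 2 + s * (∑ Y, c Y) ^ 2 := by
      have key (Y Z : F) : charVec Y.1 ⬝ᵥ charVec Z.1 = (if Y = Z then (m - s : ℝ) else 0) + s := by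
        rw [charVec_dotProduct_charVec]
        split_ifs with h
        · subst h; simp [hcard _ Y.2]
        · rw [hinter _ Y.2 _ Z.2 (fun h' => h (Subtype.ext h'))]; simp
      simp only [sum_dotProduct, dotProduct_sum, smul_dotProduct, dotProduct_smul, key, smul_eq_mul,
        mul_add, sum_add_distrib, mul_ite, mul_zero, sum_ite_eq', mem_univ, if_true]
      congr 1
      · rw [mul_sum]; exact sum_congr rfl fun _ _ => by ring
      · rw [sq, sum_mul_sum, mul_sum]
        refine sum_congr rfl fun _ _ => ?_
        rw [mul_sum, mul_sum]
        exact sum_congr rfl fun _ _ => by ring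
    rw [h0, zero_dotProduct] at h1
    have h2 : 0 ≤ ∑ Y, c Y ^ 2 := sum_nonneg fun _ _ => sq_nonneg _
    have h3 : ∑ Y, c Y ^ 2 = 0 := by
      have := mul_nonneg hs (sq_nonneg (∑ Y, c Y))
      have := mul_nonneg (sub_pos.2 hsm).le h2
      have h4 : (m - s) * ∑ Y, c Y ^ 2 = 0 := by linarith
      exact (mul_eq_zero.1 h4).resolve_left (sub_pos.2 hsm).ne'
    intro Y
    have := (sum_eq_zero_iff_of_nonneg fun _ _ => sq_nonneg _).1 h3 Y (mem_univ _)
    simpa using this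
  simpa using hb.fintype_card_le_finrank

/-- The rank of an idempotent matrix is its trace. -/
theorem finrank_range_eq_of_trace {E : Matrix V V ℝ} (hidem : E * E = E) {m : ℕ}
    (htrace : E.trace = m) : finrank ℝ (LinearMap.range (toLin' E)) = m := by
  have h : IsIdempotentElem (toLin' E) := by
    rw [IsIdempotentElem, Module.End.mul_eq_comp, ← toLin'_mul, hidem]
  have := (LinearMap.IsIdempotentElem.isProj_range _ h).trace
  rw [trace_toLin'_eq, htrace] at this
  exact_mod_cast this.symm

/-- If a symmetric matrix is `α • 1 + β • J` on `Y`, this describes its action on vectors supported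
in `Y`. -/
theorem mulVec_apply_of_support {E : Matrix V V ℝ} {Y : Finset V} {α β : ℝ}
    (hE : ∀ x ∈ Y, ∀ y ∈ Y, E x y = (if x = y then α else 0) + β) {a : V → ℝ}
    (ha : ∀ x ∉ Y, a x = 0) {y : V} (hy : y ∈ Y) :
    (E *ᵥ a) y = α * a y + β * ∑ x ∈ Y, a x := by
  have : (E *ᵥ a) y = ∑ x ∈ Y, E y x * a x := by
    rw [mulVec, dotProduct]
    exact (sum_subset (subset_univ Y) fun x _ hx => by simp [ha x hx]).symm
  rw [this, sum_congr rfl fun x hx => by rw [hE y hy x hx], mul_sum]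
  simp [add_mul, sum_add_distrib, hy]

/-- A vector in the image of an idempotent of trace `m` is determined by its restriction to an
`m`-subset on which the idempotent is positive definite of the form `α • 1 + β • J`. -/
theorem eq_zero_of_restrict_eq_zero {E : Matrix V V ℝ} (hidem : E * E = E) {m : ℕ}
    (htrace : E.trace = m) {Y : Finset V} (hY : Y.card = m) {α β : ℝ} (hα : 0 < α) (hβ : 0 < β)
    (hE : ∀ x ∈ Y, ∀ y ∈ Y, E x y = (if x = y then α else 0) + β) (g : V → ℝ)
    (hg : ∀ y ∈ Y, (E *ᵥ g) y = 0) : E *ᵥ g = 0 := by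
  let R : LinearMap.range (toLin' E) →ₗ[ℝ] (Y → ℝ) :=
    (LinearMap.funLeft ℝ ℝ (Subtype.val : Y → V)).comp (Submodule.subtype _)
  have hsurj : Function.Surjective R := by
    intro b
    have hγ : α + β * m ≠ 0 := by positivity
    let c : ℝ := β * (∑ y, b y) / (α + β * m)
    let a : V → ℝ := fun x => if h : x ∈ Y then (b ⟨x, h⟩ - c) / α else 0
    refine ⟨⟨toLin' E a, LinearMap.mem_range_self _ _⟩, ?_⟩
    ext y
    have hsum : ∑ x ∈ Y, a x = (∑ y, b y - m * c) / α := by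
      rw [← sum_coe_sort Y]
      simp [a, ← sum_div, hY]
    have := mulVec_apply_of_support hE (a := a) (fun x hx => by simp [a, hx]) y.2
    change (E *ᵥ a) y.1 = b y
    rw [this, hsum]
    simp only [a, y.2, dif_pos, c]
    field_simp
    ring
  have hinj : Function.Injective R :=
    (LinearMap.injective_iff_surjective_of_finrank_eq_finrank
      (by rw [finrank_range_eq_of_trace hidem htrace]; simp [hY])).2 hsurj
  have h0 : (⟨toLin' E g, LinearMap.mem_range_self _ _⟩ : LinearMap.range (toLin' E)) = 0 := by
    apply hinj
    rw [map_zero]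
    ext y
    exact hg y.1 y.2
  exact congrArg Subtype.val h0

/-- Equality in the ratio bound: `E` sends the characteristic vector of `Y` to its centering. -/
theorem mulVec_charVec_eq {E : Matrix V V ℝ} (hsymm : Eᵀ = E) (hidem : E * E = E)
    (hone : E *ᵥ 1 = 0) {m : ℕ} {Y : Finset V} (hY : Y.card = m) {α β p : ℝ}
    (hp : α + β * m = 1 - p) (hpv : p * Fintype.card V = m)
    (hE : ∀ x ∈ Y, ∀ y ∈ Y, E x y = (if x = y then α else 0) + β) :
    E *ᵥ charVec Y = charVec Y - p • 1 := by
  have hself (f g : V → ℝ) : (E *ᵥ f) ⬝ᵥ g = f ⬝ᵥ (E *ᵥ g) := by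
    rw [dotProduct_mulVec, ← mulVec_transpose, hsymm]
  have hq : charVec Y ⬝ᵥ (E *ᵥ charVec Y) = m * (1 - p) := by
    rw [dotProduct_comm, dotProduct_charVec,
      sum_congr rfl fun y hy => mulVec_apply_of_support hE (a := charVec Y)
        (fun x hx => by simp [charVec, hx]) hy, ← hp]
    have : ∑ x ∈ Y, charVec Y x = m := by simp [charVec, hY]
    rw [sum_add_distrib, ← mul_sum, this]
    simp [hY]
    ring
  have h11 : (1 : V → ℝ) ⬝ᵥ 1 = Fintype.card V := by simp
  have hd : (E *ᵥ charVec Y - (charVec Y - p • 1)) ⬝ᵥ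
      (E *ᵥ charVec Y - (charVec Y - p • 1)) = 0 := by
    simp only [sub_dotProduct, dotProduct_sub, smul_dotProduct, dotProduct_smul, hself,
      mulVec_mulVec, hidem, hone, hq, charVec_dotProduct_charVec, one_dotProduct_charVec,
      dotProduct_comm _ (1 : V → ℝ), ← hself 1, zero_dotProduct, h11, inter_self, hY, smul_eq_mul]
    linear_combination p * hpv
  exact sub_eq_zero.1 (dotProduct_self_eq_zero.1 hd)

/-- Distinct cocliques meeting the ratio bound have a determined intersection size. -/
theorem card_inter_eq {E : Matrix V V ℝ} (hsymm : Eᵀ = E) (hidem : E * E = E)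
    (hone : E *ᵥ 1 = 0) {m : ℕ} (htrace : E.trace = m) {α β p : ℝ} (hα : 0 < α) (hβ : 0 < β)
    (hp : α + β * m = 1 - p) (hpv : p * Fintype.card V = m) {Y Z : Finset V}
    (hY : Y.card = m) (hZ : Z.card = m)
    (hEY : ∀ x ∈ Y, ∀ y ∈ Y, E x y = (if x = y then α else 0) + β)
    (hEZ : ∀ x ∈ Z, ∀ y ∈ Z, E x y = (if x = y then α else 0) + β) (hne : Y ≠ Z) :
    ((Y ∩ Z).card : ℝ) = α * (1 - 2 * p) / β := by
  have hself (f g : V → ℝ) : (E *ᵥ f) ⬝ᵥ g = f ⬝ᵥ (E *ᵥ g) := by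
    rw [dotProduct_mulVec, ← mulVec_transpose, hsymm]
  have huY := mulVec_charVec_eq hsymm hidem hone hY hp hpv hEY
  have huZ := mulVec_charVec_eq hsymm hidem hone hZ hp hpv hEZ
  have hγ : 0 < 1 - p := by rw [← hp]; positivity
  set s : ℝ := ((Y ∩ Z).card : ℝ) with hs
  set δ : ℝ := (β * s + α * p) / (1 - p) with hδ
  have hδ' : δ * (1 - p) = β * s + α * p := div_mul_cancel₀ _ hγ.ne'
  have hf : E *ᵥ (charVec (Y ∩ Z) - α • charVec Z - δ • charVec Y) = 0 := by
    refine eq_zero_of_restrict_eq_zero hidem htrace hY hα hβ hEY _ fun y hy => ?_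
    have h1 := mulVec_apply_of_support hEY (a := charVec (Y ∩ Z))
      (fun x hx => by simp [charVec, hx]) hy
    have h2 : ∑ x ∈ Y, charVec (Y ∩ Z) x = s := by
      rw [← dotProduct_charVec, charVec_dotProduct_charVec, hs]
      congr 2
      ext; simp; tauto
    have h3 : charVec (Y ∩ Z) y = charVec Z y := by simp [charVec, hy]
    have h4 : charVec Y y = 1 := by simp [charVec, hy]
    rw [mulVec_sub, mulVec_sub, mulVec_smul, mulVec_smul, huY, huZ]
    simp only [Pi.sub_apply, Pi.smul_apply, h1, h2, h3, h4, smul_eq_mul, Pi.one_apply]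
    linear_combination -hδ'
  have h := congrArg (fun f => f ⬝ᵥ charVec Z) hf
  simp only [hself, huZ, zero_dotProduct] at h
  simp only [sub_dotProduct, dotProduct_sub, smul_dotProduct, dotProduct_smul,
    charVec_dotProduct_charVec, dotProduct_comm _ (1 : V → ℝ), one_dotProduct_charVec, smul_eq_mul,
    inter_self, hY, hZ, inter_assoc, ← hs] at h
  have hlt : s < m := by
    rw [hs, ← hY]
    refine Nat.cast_lt.2 (card_lt_card ?_)
    refine inter_subset_left.ssubset_of_ne fun h' => hne ?_
    exact eq_of_subset_of_card_le (inter_eq_left.1 h') (hY ▸ hZ.le)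
  have hfac : (s - m) * (β * s - α * (1 - 2 * p)) = 0 := by
    linear_combination -(1 - p) * h - (s - p * m) * hδ' - s * (1 - p) * hp
  rw [eq_div_iff hβ.ne']
  linarith [(mul_eq_zero.1 hfac).resolve_left (sub_neg.2 hlt).ne]

theorem card_le_of_idempotent {E : Matrix V V ℝ} (hsymm : Eᵀ = E) (hidem : E * E = E)
    (hone : E *ᵥ 1 = 0) {m : ℕ} (htrace : E.trace = m) {α β p : ℝ} (hα : 0 < α) (hβ : 0 < β)
    (hp : α + β * m = 1 - p) (hpv : p * Fintype.card V = m) (F : Finset (Finset V))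
    (hcard : ∀ Y ∈ F, Y.card = m)
    (hE : ∀ Y ∈ F, ∀ x ∈ Y, ∀ y ∈ Y, E x y = (if x = y then α else 0) + β) :
    F.card ≤ m + 1 := by
  rcases le_or_gt F.card 1 with h1 | h1
  · omega
  obtain ⟨Y, hY, Z, hZ, hne⟩ := one_lt_card.1 h1
  have hinter : ∀ Y ∈ F, ∀ Z ∈ F, Y ≠ Z → ((Y ∩ Z).card : ℝ) = α * (1 - 2 * p) / β :=
    fun Y hY Z hZ hne => card_inter_eq hsymm hidem hone htrace hα hβ hp hpv (hcard Y hY)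
      (hcard Z hZ) (hE Y hY) (hE Z hZ) hne
  have hlt : (Y ∩ Z).card < m := by
    rw [← hcard Y hY]
    refine card_lt_card (inter_subset_left.ssubset_of_ne fun h' => hne ?_)
    exact eq_of_subset_of_card_le (inter_eq_left.1 h') ((hcard Y hY).symm ▸ (hcard Z hZ).le)
  let W : Submodule ℝ (V → ℝ) := LinearMap.range (toLin' E) ⊔ Submodule.span ℝ {1}
  have hWrank : finrank ℝ W ≤ m + 1 := by
    have h2 := Submodule.finrank_add_le_finrank_add_finrank (LinearMap.range (toLin' E))
      (Submodule.span ℝ {(1 : V → ℝ)})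
    have h3 := finrank_span_le_card (R := ℝ) ({(1 : V → ℝ)} : Set (V → ℝ))
    rw [finrank_range_eq_of_trace hidem htrace] at h2
    simp only [Set.toFinset_singleton, card_singleton] at h3
    exact h2.trans (by omega)
  refine (card_le_finrank_of_constant_inter W F (hinter Y hY Z hZ hne ▸ Nat.cast_nonneg _)
    (hinter Y hY Z hZ hne ▸ Nat.cast_lt.2 hlt) hcard hinter fun Y hY => ?_).trans hWrank
  have h := mulVec_charVec_eq hsymm hidem hone (hcard Y hY) hp hpv (hE Y hY)
  rw [← sub_add_cancel (charVec Y) (p • 1), ← h]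
  exact Submodule.add_mem_sup ⟨charVec Y, rfl⟩
    (Submodule.smul_mem _ _ (Submodule.mem_span_singleton_self _))

end

section

open Matrix Finset

variable {V : Type*} {G : SimpleGraph V} [DecidableRel G.Adj]

theorem SimpleGraph.IsSRGWith.mu_ne_zero_s4 [Fintype V] [Nontrivial V] {v k l m : ℕ}
    (hsrg : G.IsSRGWith v k l m)
    (hconn : G.Connected) (hconnCompl : Gᶜ.Connected) : m ≠ 0 := by
  rintro rfl
  have htrans : ∀ x y z, G.Adj x y → G.Adj y z → x ≠ z → G.Adj x z := by
    intro x y z hxy hyz hne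
    by_contra hna
    have := hsrg.of_not_adj hne hna
    rw [Fintype.card_eq_zero_iff] at this
    exact this.elim ⟨y, hxy, hyz.symm⟩
  have hreach : ∀ x y, G.Walk x y → x = y ∨ G.Adj x y := by
    intro x y w
    induction w with
    | nil => exact Or.inl rfl
    | cons h _ ih =>
      rcases ih with rfl | h'
      · exact Or.inr h
      · exact or_iff_not_imp_left.2 (htrans _ _ _ h h')
  obtain ⟨x⟩ := hconnCompl.nonempty
  obtain ⟨y, hy⟩ := hconnCompl.preconnected.exists_adj_of_nontrivial x
  obtain ⟨w⟩ := hconn.preconnected x y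
  exact (hreach x y w).elim hy.ne ((SimpleGraph.compl_adj _ _ _).1 hy).2

theorem SimpleGraph.IsSRGWith.mu_ne_degree_s4 [Fintype V] [DecidableEq V] [Nontrivial V] {v k l m : ℕ}
    (hsrg : G.IsSRGWith v k l m) (hconn : G.Connected) (hconnCompl : Gᶜ.Connected) : m ≠ k := by
  rintro rfl
  have hnbr : ∀ x y, Gᶜ.Adj x y → G.neighborFinset x = G.neighborFinset y := by
    intro x y hxy
    have hna := ((SimpleGraph.compl_adj _ _ _).1 hxy).2
    have h1 := hsrg.card_neighborFinset_union_of_not_adj hxy.ne hna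
    have hx : (G.neighborFinset x).card = m := by simpa using hsrg.regular.degree_eq x
    have hy : (G.neighborFinset y).card = m := by simpa using hsrg.regular.degree_eq y
    rw [eq_of_subset_of_card_le (subset_union_left (s₁ := G.neighborFinset x)
      (s₂ := G.neighborFinset y)) (by omega)]
    exact (eq_of_subset_of_card_le subset_union_right (by omega)).symm
  have hreach : ∀ x y, Gᶜ.Walk x y → G.neighborFinset x = G.neighborFinset y := by
    intro x y w
    induction w with
    | nil => rfl
    | cons h _ ih => exact (hnbr _ _ h).trans ih
  obtain ⟨x⟩ := hconn.nonempty
  obtain ⟨y, hy⟩ := hconn.preconnected.exists_adj_of_nontrivial x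
  obtain ⟨w⟩ := hconnCompl.preconnected x y
  have := hreach x y w
  have h : y ∈ G.neighborFinset x := by simpa using hy
  rw [this] at h
  simp at h

/-- The adjacency matrix of a strongly regular graph squared, as a combination of `1`, `A`, `J`. -/
theorem SimpleGraph.IsSRGWith.adjMatrix_mul_self_s4 [Fintype V] [DecidableEq V] {v k l m : ℕ}
    (hsrg : G.IsSRGWith v k l m) :
    G.adjMatrix ℝ * G.adjMatrix ℝ = ((k : ℝ) - m) • (1 : Matrix V V ℝ)
      + ((l : ℝ) - m) • G.adjMatrix ℝ + (m : ℝ) • Matrix.of (fun _ _ => (1 : ℝ)) := by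
  rw [← sq, hsrg.matrix_eq]
  ext x y
  simp only [Matrix.add_apply, Matrix.smul_apply]
  by_cases hxy : x = y
  · subst hxy; simp
  · by_cases ha : G.Adj x y <;> simp [hxy, ha]

theorem SimpleGraph.IsSRGWith.adjMatrix_mulVec_one [Fintype V] {v k l m : ℕ}
    (hsrg : G.IsSRGWith v k l m) :
    G.adjMatrix ℝ *ᵥ 1 = (k : ℝ) • 1 := by
  ext x
  simp [hsrg.regular.degree_eq x]

theorem SimpleGraph.IsSRGWith.real_param_eq [Fintype V] [DecidableEq V] [Nonempty V] {v k l m : ℕ}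
    (hsrg : G.IsSRGWith v k l m) :
    (k : ℝ) * k = (k - m) + (l - m) * k + m * v := by
  have h := congrArg (· *ᵥ (1 : V → ℝ)) hsrg.adjMatrix_mul_self_s4
  simp only [← mulVec_mulVec, hsrg.adjMatrix_mulVec_one, mulVec_smul, add_mulVec, smul_mulVec,
    one_mulVec] at h
  obtain ⟨x⟩ := ‹Nonempty V›
  have := congrFun h x
  simpa [mulVec, dotProduct, hsrg.card] using this

/-- The orthogonal projection onto the eigenspace of the adjacency matrix for the eigenvalue `f`,
when `G` is strongly regular on `v` vertices with eigenvalues `k`, `e`, `f`. -/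
noncomputable def SimpleGraph.eigenProj [DecidableEq V] (G : SimpleGraph V) [DecidableRel G.Adj]
    (v k e f : ℝ) :
    Matrix V V ℝ :=
  (e - f)⁻¹ • (e • 1 - G.adjMatrix ℝ + ((k - e) / v) • Matrix.of (fun _ _ => (1 : ℝ)))

theorem SimpleGraph.transpose_eigenProj [DecidableEq V] (v k e f : ℝ) :
    (G.eigenProj v k e f)ᵀ = G.eigenProj v k e f := by
  ext x y
  simp [SimpleGraph.eigenProj, Matrix.one_apply, eq_comm, G.adj_comm, mul_add]

theorem SimpleGraph.IsSRGWith.eigenProj_mulVec_one [Fintype V] [DecidableEq V] {v k l m : ℕ}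
    (hsrg : G.IsSRGWith v k l m)
    (hv : (v : ℝ) ≠ 0) (e f : ℝ) : G.eigenProj v k e f *ᵥ 1 = 0 := by
  have hJ : Matrix.of (fun _ _ : V => (1 : ℝ)) *ᵥ 1 = (v : ℝ) • 1 := by
    ext x; simp [mulVec, dotProduct, hsrg.card]
  rw [SimpleGraph.eigenProj, smul_mulVec, add_mulVec, sub_mulVec, hsrg.adjMatrix_mulVec_one,
    smul_mulVec, smul_mulVec, one_mulVec, hJ, smul_smul, div_mul_cancel₀ _ hv]
  module

theorem SimpleGraph.IsSRGWith.eigenProj_mul_self [Fintype V] [DecidableEq V] {v k l m : ℕ}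
    (hsrg : G.IsSRGWith v k l m)
    (hv : (v : ℝ) ≠ 0) {e f : ℝ} (hef : e ≠ f) (hadd : e + f = l - m) (hmul : e * f = m - k)
    (hvm : (k - e) * (k - f) = v * m) :
    G.eigenProj v k e f * G.eigenProj v k e f = G.eigenProj v k e f := by
  have hD : e - f ≠ 0 := sub_ne_zero.2 hef
  have hJJ : Matrix.of (fun _ _ : V => (1 : ℝ)) * Matrix.of (fun _ _ : V => (1 : ℝ))
      = (v : ℝ) • Matrix.of (fun _ _ : V => (1 : ℝ)) := by
    ext x y; simp [Matrix.mul_apply, hsrg.card]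
  have hAJ : G.adjMatrix ℝ * Matrix.of (fun _ _ : V => (1 : ℝ))
      = (k : ℝ) • Matrix.of (fun _ _ : V => (1 : ℝ)) := by
    ext x y; simp [hsrg.regular.degree_eq x]
  have hJA : Matrix.of (fun _ _ : V => (1 : ℝ)) * G.adjMatrix ℝ
      = (k : ℝ) • Matrix.of (fun _ _ : V => (1 : ℝ)) := by
    ext x y; simp [hsrg.regular.degree_eq y]
  have hkm : (k : ℝ) - m = -(e * f) := by rw [hmul]; ring
  have hAA := hsrg.adjMatrix_mul_self_s4
  rw [hkm, ← hadd] at hAA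
  have hc : (k - e) / v * (k - f) = m := by field_simp; linarith
  have hcv : (k - e) / v * v = k - e := div_mul_cancel₀ _ hv
  rw [SimpleGraph.eigenProj]
  generalize ((k : ℝ) - e) / v = c at *
  generalize Matrix.of (fun _ _ : V => (1 : ℝ)) = J at *
  rw [smul_mul_smul_comm, mul_smul]
  congr 1
  rw [inv_smul_eq_iff₀ hD]
  simp only [sub_mul, add_mul, mul_sub, mul_add, smul_mul_assoc, mul_smul_comm, one_mul, mul_one,
    hAA, hAJ, hJA, hJJ]
  have h1 : (m : ℝ) - c * k - c * k + c * e + c * e + c * c * v = (e - f) * c := by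
    linear_combination -hc + c * hcv
  rw [smul_add (e - f), smul_smul (e - f) c, ← h1]
  module

theorem SimpleGraph.IsSRGWith.trace_eigenProj [Fintype V] [DecidableEq V] {v k l m : ℕ}
    (hsrg : G.IsSRGWith v k l m)
    (hv : (v : ℝ) ≠ 0) (e f : ℝ) :
    (G.eigenProj v k e f).trace = (v * e + k - e) / (e - f) := by
  have hJ : (Matrix.of (fun _ _ : V => (1 : ℝ))).trace = v := by simp [Matrix.trace, hsrg.card]
  rw [SimpleGraph.eigenProj, trace_smul, trace_add, trace_sub, trace_smul, trace_smul, hJ,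
    trace_one, hsrg.card, SimpleGraph.trace_adjMatrix]
  simp only [smul_eq_mul, div_mul_cancel₀ _ hv]
  ring

theorem IsCoclique.eigenProj_apply [DecidableEq V] {Y : Finset V} (hY : IsCoclique G Y)
    (v k e f : ℝ) :
    ∀ x ∈ Y, ∀ y ∈ Y, G.eigenProj v k e f x y =
      (if x = y then e / (e - f) else 0) + (k - e) / v / (e - f) := by
  intro x hx y hy
  by_cases hxy : x = y
  · subst hxy
    simp [SimpleGraph.eigenProj]
    ring
  · simp [SimpleGraph.eigenProj, hY x hx y hy, hxy]
    ring

end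

theorem srg_delsarte_cocliques_count_le
    {V : Type*} [Fintype V] [DecidableEq V] (G : SimpleGraph V) [DecidableRel G.Adj]
    (v k l m : ℕ) (eP eN : ℤ) (mN : ℕ)
    (hsrg : G.IsSRGWith v k l m)
    (hconn : G.Connected) (hconnCompl : Gᶜ.Connected)
    (heP : 0 ≤ eP) (heN : eN < 0)
    (hProot : eP ^ 2 - ((l : ℤ) - (m : ℤ)) * eP - ((k : ℤ) - (m : ℤ)) = 0)
    (hNroot : eN ^ 2 - ((l : ℤ) - (m : ℤ)) * eN - ((k : ℤ) - (m : ℤ)) = 0)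
    (hmult : (mN : ℚ) = (v : ℚ) - 1 -
      ((eN : ℚ) + 1) * (k : ℚ) * ((k : ℚ) - (eN : ℚ)) / ((m : ℚ) * ((eN : ℚ) - (eP : ℚ))))
    (hbound : (v : ℤ) * eN = (mN : ℤ) * (eN - (k : ℤ))) :
    {Y : Finset V | IsDelsarteCoclique G v k eN Y}.ncard ≤ mN + 1 := by
  classical
  have := hconn.nonempty
  have hv0 : 0 < v := hsrg.card ▸ Fintype.card_pos
  have hNk : eN - (k : ℤ) < 0 := by omega
  -- the one-vertex graph violates the hypotheses on `mN`
  have hnt : Nontrivial V := by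
    by_contra hn
    rw [not_nontrivial_iff_subsingleton] at hn
    have hv1 : v = 1 := by
      have := Fintype.card_le_one_iff_subsingleton.2 hn
      have := hsrg.card
      omega
    have hk : k = 0 := by
      obtain ⟨x⟩ := ‹Nonempty V›
      have := G.degree_lt_card_verts x
      rw [hsrg.regular.degree_eq, hsrg.card] at this
      omega
    subst hv1 hk
    have : mN = 0 := by simpa using hmult
    subst this
    simp at hbound
    omega
  have hm0 := hsrg.mu_ne_zero_s4 hconn hconnCompl
  have hmk := hsrg.mu_ne_degree_s4 hconn hconnCompl
  have haddZ : eP + eN = l - m := by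
    have : (eP - eN) * (eP + eN - (l - m)) = 0 := by linear_combination hProot - hNroot
    linarith [(mul_eq_zero.1 this).resolve_left (by omega)]
  have hmulZ : eP * eN = m - k := by linear_combination hNroot * (-1) + eN * haddZ
  have hP0 : 0 < eP := by
    refine lt_of_le_of_ne heP fun h => hmk ?_
    rw [← h] at hmulZ
    omega
  have hadd : (eP : ℝ) + eN = l - m := by exact_mod_cast haddZ
  have hmul : (eP : ℝ) * eN = m - k := by exact_mod_cast hmulZ
  have hvR : (0 : ℝ) < v := by exact_mod_cast hv0
  have hmR : (0 : ℝ) < m := by exact_mod_cast Nat.pos_of_ne_zero hm0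
  have hPR : (0 : ℝ) < eP := by exact_mod_cast hP0
  have hNR : (eN : ℝ) < 0 := by exact_mod_cast heN
  have hkR : (0 : ℝ) ≤ k := Nat.cast_nonneg k
  have hparam := hsrg.real_param_eq
  have hvm : ((k : ℝ) - eP) * (k - eN) = v * m := by
    linear_combination hparam - k * hadd + hmul
  have hkP : (0 : ℝ) < k - eP :=
    pos_of_mul_pos_left (hvm ▸ mul_pos hvR hmR) (by linarith)
  have hD : (0 : ℝ) < eP - eN := by linarith
  have hboundR : (v : ℝ) * eN = mN * (eN - k) := by exact_mod_cast hbound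
  have hmultR : (mN : ℝ) = (v : ℝ) - 1 -
      ((eN : ℝ) + 1) * (k : ℝ) * ((k : ℝ) - (eN : ℝ)) / ((m : ℝ) * ((eN : ℝ) - (eP : ℝ))) := by
    exact_mod_cast congrArg (Rat.cast : ℚ → ℝ) hmult
  have htr : (v * eP + k - eP : ℝ) / (eP - eN) = mN := by
    have hD' : (eN : ℝ) - eP ≠ 0 := by linarith
    have hkey : ((eN : ℝ) + 1) * k * (k - eN) = m * (v * eN + k - eN) := by
      linear_combination eN * hvm + (k - eN) * hmul
    rw [hmultR, hkey, mul_div_mul_left _ _ hmR.ne', ← neg_sub (eN : ℝ) eP]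
    field_simp
    ring
  have hcardY : ∀ Y : Finset V, IsDelsarteCoclique G v k eN Y → Y.card = mN := by
    intro Y hY
    exact_mod_cast mul_right_cancel₀ hNk.ne (hY.2.trans hbound)
  rw [Set.ncard_eq_toFinset_card']
  refine card_le_of_idempotent (E := G.eigenProj v k eP eN) (α := eP / (eP - eN))
    (β := (k - eP) / v / (eP - eN)) (p := mN / v)
    (SimpleGraph.transpose_eigenProj _ _ _ _)
    (hsrg.eigenProj_mul_self hvR.ne' (by linarith) hadd hmul hvm)
    (hsrg.eigenProj_mulVec_one hvR.ne' _ _)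
    ((hsrg.trace_eigenProj hvR.ne' _ _).trans htr) (by positivity) (by positivity) ?_ ?_ _ ?_ ?_
  · have hNk' : (eN : ℝ) - k ≠ 0 := by linarith
    rw [eq_div_of_mul_eq hNk' hboundR.symm]
    field_simp
    ring
  · rw [hsrg.card, div_mul_cancel₀ _ hvR.ne']
  · intro Y hY
    exact hcardY Y (by simpa using hY)
  · intro Y hY
    have hY' : IsDelsarteCoclique G v k eN Y := by simpa using hY
    exact hY'.1.eigenProj_apply _ _ _ _
end
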